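/- arXiv:1603.09304 — 2 statements merged into one kernel-verified Lean document; each statement's English description precedes it below -/
import Mathlib

section
/- Let (E, {f_i}_{i=1}^m) ∈ 𝓔. Then dim_H U_{2^{ℵ₀}}(E) = dim_H E. Furthermore, 0 < H^{dim_H E}(U_{2^{ℵ₀}}(E)) < ∞, where H^s denotes the s-dimensional Hausdorff measure. -/
open Set Filter MeasureTheory

/-- A self-similar iterated function system on `ℝ` given by `m` similitudes
`f i x = r i * x + t i` (for `1 ≤ i ≤ m`, `m ≥ 3`), together with its attractor `E`:
the unique nonempty compact set with `E = ⋃_{i=1}^m f_i(E)`. -/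
structure ClassE where
  m : ℕ
  r : ℕ → ℝ
  t : ℕ → ℝ
  E : Set ℝ
  hm : 3 ≤ m
  hr : ∀ i, 1 ≤ i → i ≤ m → 0 < r i ∧ r i < 1
  hEne : E.Nonempty
  hEcpt : IsCompact E
  hEinv : E = ⋃ i ∈ Finset.Icc 1 m, (fun x => r i * x + t i) '' E

namespace ClassE

/-- The `i`-th similitude. -/
def f (S : ClassE) (i : ℕ) (x : ℝ) : ℝ := S.r i * x + S.t i

/-- Left endpoint `a` of the convex hull of `E`. -/
noncomputable def a (S : ClassE) : ℝ := sInf S.E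

/-- Right endpoint `b` of the convex hull of `E`. -/
noncomputable def b (S : ClassE) : ℝ := sSup S.E

/-- The convex hull `I = [a, b]` of `E`. -/
noncomputable def I (S : ClassE) : Set ℝ := Set.Icc S.a S.b

/-- Condition (A): `a = f_1(a) < f_2(a) < ⋯ < f_m(a) < f_m(b) = b`. -/
def condA (S : ClassE) : Prop :=
  S.f 1 S.a = S.a ∧ (∀ i, 1 ≤ i → i < S.m → S.f i S.a < S.f (i + 1) S.a) ∧
    S.f S.m S.a < S.f S.m S.b ∧ S.f S.m S.b = S.b

/-- Condition (B): `f_i(I) ∩ f_{i+2}(I) = ∅` for all `1 ≤ i ≤ m - 2`. -/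
def condB (S : ClassE) : Prop :=
  ∀ i, 1 ≤ i → i + 2 ≤ S.m → S.f i '' S.I ∩ S.f (i + 2) '' S.I = ∅

/-- Condition (C): there are `i, j ∈ {1, …, m-1}` with `f_i(I) ∩ f_{i+1}(I) = ∅` and
`f_j(I) ∩ f_{j+1}(I) ≠ ∅`. -/
def condC (S : ClassE) : Prop :=
  (∃ i, 1 ≤ i ∧ i + 1 ≤ S.m ∧ S.f i '' S.I ∩ S.f (i + 1) '' S.I = ∅) ∧
    (∃ j, 1 ≤ j ∧ j + 1 ≤ S.m ∧ S.f j '' S.I ∩ S.f (j + 1) '' S.I ≠ ∅)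

/-- Condition (D): whenever `f_i(I) ∩ f_{i+1}(I) ≠ ∅` there are `u, v ≥ 1` with
`f_i(I) ∩ f_{i+1}(I) = f_i ∘ f_m^u (I) = f_{i+1} ∘ f_1^v (I)`. -/
def condD (S : ClassE) : Prop :=
  ∀ i, 1 ≤ i → i + 1 ≤ S.m → S.f i '' S.I ∩ S.f (i + 1) '' S.I ≠ ∅ →
    ∃ u v : ℕ, 1 ≤ u ∧ 1 ≤ v ∧
      S.f i '' S.I ∩ S.f (i + 1) '' S.I = (S.f i ∘ (S.f S.m)^[u]) '' S.I ∧
      S.f i '' S.I ∩ S.f (i + 1) '' S.I = (S.f (i + 1) ∘ (S.f 1)^[v]) '' S.I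

/-- Membership in the class `𝓔`: conditions (A)–(D). -/
def goodE (S : ClassE) : Prop := S.condA ∧ S.condB ∧ S.condC ∧ S.condD

/-- `prefixMap d n = f_{d 0} ∘ f_{d 1} ∘ ⋯ ∘ f_{d (n-1)}`. -/
def prefixMap (S : ClassE) (d : ℕ → ℕ) : ℕ → ℝ → ℝ
  | 0 => id
  | n + 1 => S.prefixMap d n ∘ S.f (d n)

/-- `d : ℕ → ℕ` (with digits in `{1, …, m}`) is a coding of `x` if
`x = lim_n f_{d 0} ∘ ⋯ ∘ f_{d (n-1)} (0)`. -/
def isCoding (S : ClassE) (d : ℕ → ℕ) (x : ℝ) : Prop :=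
  (∀ n, 1 ≤ d n ∧ d n ≤ S.m) ∧
    Tendsto (fun n => S.prefixMap d n 0) atTop (nhds x)

/-- The set of codings of `x`. -/
def codings (S : ClassE) (x : ℝ) : Set (ℕ → ℕ) := {d | S.isCoding d x}

/-- `U k E`: the set of points of `E` having exactly `k` distinct codings
(`k` a cardinal; e.g. `k = ℵ₀` for countably infinitely many codings,
`k = 𝔠 = 2^ℵ₀` for a continuum of codings). -/
def U (S : ClassE) (k : Cardinal) : Set ℝ :=
  {x ∈ S.E | Cardinal.mk (S.codings x) = k}

end ClassE

open ClassE

structure Dat where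
  m : ℕ
  hm : 3 ≤ m
  r : ℕ → ℝ
  t : ℕ → ℝ
  a : ℝ
  b : ℝ
  hab : a < b
  ov : ℕ → Prop
  u : ℕ → ℕ
  v : ℕ → ℕ
  s : ℝ
  hs : 0 < s
  c : ℕ → ℝ
  q : ℝ
  hq : q < 1
  hr : ∀ i, 1 ≤ i → i ≤ m → 0 < r i
  hrq : ∀ i, 1 ≤ i → i ≤ m → r i ≤ q
  hpq : ∀ i, 1 ≤ i → i ≤ m → r i ^ s ≤ q
  fa : r 1 * a + t 1 = a
  fb : r m * b + t m = b
  lt : ∀ i, 1 ≤ i → i < m → r i * a + t i < r (i+1) * a + t (i+1)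
  hB : ∀ i, 1 ≤ i → i + 2 ≤ m → r i * b + t i < r (i+2) * a + t (i+2)
  hu : ∀ i, 1 ≤ i → i < m → ov i → 1 ≤ u i
  hv : ∀ i, 1 ≤ i → i < m → ov i → 1 ≤ v i
  hD : ∀ i, 1 ≤ i → i < m → ov i → ∀ z,
    r i * ((fun x => r m * x + t m)^[u i] z) + t i
      = r (i+1) * ((fun x => r 1 * x + t 1)^[v i] z) + t (i+1)
  hDr : ∀ i, 1 ≤ i → i < m → ov i → r i * r m ^ u i = r (i+1) * r 1 ^ v i
  hgap : ∀ i, 1 ≤ i → i < m → ¬ ov i → r i * b + t i < r (i+1) * a + t (i+1)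
  c1 : c 1 = 0
  cov : ∀ i, 1 ≤ i → i < m → ov i → c (i+1) = c i + r i ^ s - r i ^ s * (r m ^ s) ^ u i
  cgap : ∀ i, 1 ≤ i → i < m → ¬ ov i → c (i+1) = c i + r i ^ s
  cm : c m + r m ^ s = 1

namespace Dat
noncomputable section
variable (D : Dat)

def f (i : ℕ) (x : ℝ) : ℝ := D.r i * x + D.t i
def p (i : ℕ) : ℝ := D.r i ^ D.s
def g (i : ℕ) (y : ℝ) : ℝ := D.c i + D.p i * y

lemma p_pos (i : ℕ) (h1 : 1 ≤ i) (h2 : i ≤ D.m) : 0 < D.p i := Real.rpow_pos_of_pos (D.hr i h1 h2) _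

lemma q_pos : 0 < D.q := lt_of_lt_of_le (D.hr 1 le_rfl (by have := D.hm; omega)) (D.hrq 1 le_rfl (by have := D.hm; omega))

lemma fmono (i : ℕ) (h1 : 1 ≤ i) (h2 : i ≤ D.m) {x y : ℝ} (h : x ≤ y) : D.f i x ≤ D.f i y := by
  have := D.hr i h1 h2
  unfold f; gcongr

lemma flt (i : ℕ) (h1 : 1 ≤ i) (h2 : i ≤ D.m) {x y : ℝ} (h : x < y) : D.f i x < D.f i y := by
  have := D.hr i h1 h2
  unfold f; gcongr

lemma f1a : D.f 1 D.a = D.a := D.fa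
lemma fmb : D.f D.m D.b = D.b := D.fb

lemma fa_mono {i j : ℕ} (h1 : 1 ≤ i) (hij : i ≤ j) (h2 : j ≤ D.m) : D.f i D.a ≤ D.f j D.a := by
  induction j, hij using Nat.le_induction with
  | base => exact le_rfl
  | succ k hk ih => exact (ih (by omega)).trans (D.lt k (by omega) (by omega)).le

lemma fb_le (i : ℕ) (h1 : 1 ≤ i) (h2 : i ≤ D.m) : D.f i D.b ≤ D.b := by
  have hstep : ∀ i, 1 ≤ i → i < D.m → D.f i D.b ≤ D.f (i+1) D.b := by
    intro i h1 h2
    by_cases h : D.ov i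
    · have h3 := D.hD i h1 h2 h D.b
      have e1 : (fun x => D.r D.m * x + D.t D.m)^[D.u i] D.b = D.b :=
        Function.iterate_fixed D.fb _
      rw [e1] at h3
      have e2 : ∀ n, (fun x => D.r 1 * x + D.t 1)^[n] D.b ≤ D.b ∧ D.a ≤ (fun x => D.r 1 * x + D.t 1)^[n] D.b := by
        intro n
        have hlt : D.f 1 D.b ≤ D.b := by
          have h5 := D.hB 1 le_rfl D.hm
          have h6 : D.f 3 D.a ≤ D.f D.m D.a := D.fa_mono (by omega) D.hm le_rfl
          have h7 := D.fmono D.m (by omega) le_rfl D.hab.le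
          rw [D.fmb] at h7
          unfold f at *
          linarith
        induction n with
        | zero => exact ⟨le_rfl, D.hab.le⟩
        | succ n ih =>
          rw [Function.iterate_succ_apply']
          constructor
          · exact (D.fmono 1 le_rfl (by omega) ih.1).trans hlt
          · have := D.fmono 1 le_rfl (by omega) ih.2
            rw [D.f1a] at this; exact this
      have h4 := D.fmono (i+1) (by omega) (by omega) (e2 (D.v i)).1
      unfold f at *
      linarith
    · have h3 := D.hgap i h1 h2 h
      have h4 := D.fmono (i+1) (by omega) (by omega) D.hab.le
      unfold f at *
      linarith
  have : ∀ k, i + k ≤ D.m → D.f i D.b ≤ D.f (i + k) D.b := by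
    intro k
    induction k with
    | zero => intro _; exact le_rfl
    | succ k ih => intro h; exact (ih (by omega)).trans (hstep (i+k) (by omega) (by omega))
  have h3 := this (D.m - i) (by omega)
  rwa [show i + (D.m - i) = D.m by omega, D.fmb] at h3

lemma f_mem (i : ℕ) (h1 : 1 ≤ i) (h2 : i ≤ D.m) {x : ℝ} (hx : x ∈ Icc D.a D.b) : D.f i x ∈ Icc D.a D.b := by
  constructor
  · have h3 := D.fa_mono le_rfl h1 h2
    rw [D.f1a] at h3
    exact h3.trans (D.fmono i h1 h2 hx.1)
  · exact (D.fmono i h1 h2 hx.2).trans (D.fb_le i h1 h2)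

open Classical in
def idx (x : ℝ) : ℕ := Nat.findGreatest (fun i => 1 ≤ i ∧ D.f i D.a ≤ x) D.m

lemma idx_spec {x : ℝ} (hx : x ∈ Icc D.a D.b) : 1 ≤ D.idx x ∧ D.f (D.idx x) D.a ≤ x := by
  classical
  unfold idx
  have := D.hm
  exact Nat.findGreatest_spec (P := fun i => 1 ≤ i ∧ D.f i D.a ≤ x) (m := 1) (by omega) ⟨le_rfl, by rw [D.f1a]; exact hx.1⟩

lemma idx_le (x : ℝ) : D.idx x ≤ D.m := by
  classical
  exact Nat.findGreatest_le _

lemma lt_of_idx_lt {x : ℝ} {j : ℕ} (h : D.idx x < j) (hj : j ≤ D.m) : x < D.f j D.a := by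
  classical
  have := Nat.findGreatest_is_greatest h hj
  by_contra h2
  exact this ⟨by omega, not_lt.1 h2⟩

lemma idx_eq {x : ℝ} {i : ℕ} (h1 : 1 ≤ i) (h2 : i ≤ D.m) (h3 : D.f i D.a ≤ x)
    (h4 : i < D.m → x < D.f (i+1) D.a) : D.idx x = i := by
  classical
  apply le_antisymm
  · by_contra h5
    push Not at h5
    have h6 : D.idx x ≤ D.m := D.idx_le x
    have h7 := Nat.findGreatest_of_ne_zero (P := fun i => 1 ≤ i ∧ D.f i D.a ≤ x) (n := D.m) (m := D.idx x) rfl (by omega)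
    have h8 := h4 (by omega)
    have h9 := D.fa_mono (i := i+1) (j := D.idx x) (by omega) (by omega) h6
    linarith [h7.2]
  · exact Nat.le_findGreatest h2 ⟨h1, h3⟩

def tau (x : ℝ) : ℝ := min D.b ((x - D.t (D.idx x)) / D.r (D.idx x))

lemma tau_mem {x : ℝ} (hx : x ∈ Icc D.a D.b) : D.tau x ∈ Icc D.a D.b := by
  have h := D.idx_spec hx
  refine ⟨?_, min_le_left _ _⟩
  refine le_min D.hab.le ?_
  rw [le_div_iff₀ (D.hr _ h.1 (D.idx_le x))]
  have := h.2
  unfold f at this; linarith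

lemma c_step (i : ℕ) (h1 : 1 ≤ i) (h2 : i < D.m) : D.c i ≤ D.c (i+1) ∧ D.c (i+1) ≤ D.c i + D.p i ∧ D.c i + D.p i ≤ D.c (i+1) + D.p (i+1) := by
  have hp := D.p_pos i h1 (by omega)
  have hp' := D.p_pos (i+1) (by omega) (by omega)
  by_cases h : D.ov i
  · have e := D.cov i h1 h2 h
    have hpm := D.p_pos D.m (by omega) le_rfl
    have hp1 := D.p_pos 1 (by omega) (by omega)
    have hq1 : D.p D.m ≤ D.q := D.hpq D.m (by omega) le_rfl
    have hq2 : D.p 1 ≤ D.q := D.hpq 1 (by omega) (by omega)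
    have hq := D.hq
    have l1 : D.p D.m ^ D.u i ≤ 1 := pow_le_one₀ hpm.le (by linarith)
    have l2 : D.p 1 ^ D.v i ≤ 1 := pow_le_one₀ hp1.le (by linarith)
    have l0 : 0 < D.p D.m ^ D.u i := by positivity
    have e2 : D.p i * D.p D.m ^ D.u i = D.p (i+1) * D.p 1 ^ D.v i := by
      have := D.hDr i h1 h2 h
      unfold p
      have k1 := D.hr i h1 h2.le
      have k2 := D.hr (i+1) (by omega) (by omega)
      have k3 := D.hr 1 (by omega) (by omega)
      have k4 := D.hr D.m (by omega) (by omega)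
      rw [← Real.rpow_natCast, ← Real.rpow_natCast, ← Real.rpow_mul k4.le, ← Real.rpow_mul k3.le, mul_comm D.s, mul_comm D.s,
        Real.rpow_mul k4.le, Real.rpow_mul k3.le, ← Real.mul_rpow k1.le (by positivity), ← Real.mul_rpow k2.le (by positivity),
        Real.rpow_natCast, Real.rpow_natCast, this]
    change D.c (i+1) = D.c i + D.p i - D.p i * D.p D.m ^ D.u i at e
    refine ⟨?_, ?_, ?_⟩ <;> nlinarith
  · have e := D.cgap i h1 h2 h
    change D.c (i+1) = D.c i + D.p i at e
    refine ⟨?_, ?_, ?_⟩ <;> linarith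

lemma p_ov (i : ℕ) (h1 : 1 ≤ i) (h2 : i < D.m) (h : D.ov i) : D.p i * D.p D.m ^ D.u i = D.p (i+1) * D.p 1 ^ D.v i := by
  have := D.hDr i h1 h2 h
  unfold p
  have k1 := D.hr i h1 h2.le
  have k2 := D.hr (i+1) (by omega) (by omega)
  have k3 := D.hr 1 (by omega) (by omega)
  have k4 := D.hr D.m (by omega) (by omega)
  rw [← Real.rpow_natCast, ← Real.rpow_natCast, ← Real.rpow_mul k4.le, ← Real.rpow_mul k3.le, mul_comm D.s, mul_comm D.s,
    Real.rpow_mul k4.le, Real.rpow_mul k3.le, ← Real.mul_rpow k1.le (by positivity), ← Real.mul_rpow k2.le (by positivity),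
    Real.rpow_natCast, Real.rpow_natCast, this]

lemma c_mono {i j : ℕ} (h1 : 1 ≤ i) (hij : i ≤ j) (h2 : j ≤ D.m) : D.c i ≤ D.c j ∧ D.c i + D.p i ≤ D.c j + D.p j := by
  induction j, hij using Nat.le_induction with
  | base => exact ⟨le_rfl, le_rfl⟩
  | succ k hk ih =>
    have := D.c_step k (by omega) (by omega)
    exact ⟨(ih (by omega)).1.trans this.1, (ih (by omega)).2.trans this.2.2⟩

lemma c_nonneg (i : ℕ) (h1 : 1 ≤ i) (h2 : i ≤ D.m) : 0 ≤ D.c i := by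
  rw [← D.c1]; exact (D.c_mono le_rfl h1 h2).1

lemma cp_le (i : ℕ) (h1 : 1 ≤ i) (h2 : i ≤ D.m) : D.c i + D.p i ≤ 1 := by
  have := (D.c_mono h1 h2 le_rfl).2
  have h := D.cm
  change D.c D.m + D.p D.m = 1 at h
  linarith

def Fn : ℕ → ℝ → ℝ
  | 0, _ => 0
  | n+1, x => D.g (D.idx x) (Fn n (D.tau x))

lemma Fn_bd (n : ℕ) : ∀ x ∈ Icc D.a D.b, 0 ≤ D.Fn n x ∧ D.Fn n x ≤ 1 := by
  induction n with
  | zero => intro x _; simp [Fn]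
  | succ n ih =>
    intro x hx
    have h1 := D.idx_spec hx
    have h2 := ih _ (D.tau_mem hx)
    have h3 := D.c_nonneg _ h1.1 (D.idx_le x)
    have h4 := D.cp_le _ h1.1 (D.idx_le x)
    have h5 := D.p_pos _ h1.1 (D.idx_le x)
    simp only [Fn, g]
    constructor
    · have := h2.1; positivity
    · nlinarith

lemma Fn_mono (n : ℕ) : ∀ x ∈ Icc D.a D.b, D.Fn n x ≤ D.Fn (n+1) x := by
  induction n with
  | zero => intro x hx; exact (D.Fn_bd 1 x hx).1
  | succ n ih =>
    intro x hx
    have h1 := D.idx_spec hx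
    have h2 := ih _ (D.tau_mem hx)
    have h5 := D.p_pos _ h1.1 (D.idx_le x)
    rw [Fn, Fn]
    unfold g
    gcongr

def F (x : ℝ) : ℝ := ⨆ n, D.Fn n x

lemma F_tendsto {x : ℝ} (hx : x ∈ Icc D.a D.b) : Tendsto (fun n => D.Fn n x) atTop (nhds (D.F x)) := by
  apply tendsto_atTop_ciSup
  · exact monotone_nat_of_le_succ (fun n => D.Fn_mono n x hx)
  · exact ⟨1, by rintro _ ⟨n, rfl⟩; exact (D.Fn_bd n x hx).2⟩

lemma F_eq {x : ℝ} (hx : x ∈ Icc D.a D.b) : D.F x = D.g (D.idx x) (D.F (D.tau x)) := by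
  have h1 := (D.F_tendsto hx).comp (tendsto_add_atTop_nat 1)
  have h2 := ((D.F_tendsto (D.tau_mem hx)).const_mul (D.p (D.idx x))).const_add (D.c (D.idx x))
  exact tendsto_nhds_unique h1 h2

lemma F_nonneg {x : ℝ} (hx : x ∈ Icc D.a D.b) : 0 ≤ D.F x :=
  ge_of_tendsto' (D.F_tendsto hx) (fun n => (D.Fn_bd n x hx).1)
lemma F_le {x : ℝ} (hx : x ∈ Icc D.a D.b) : D.F x ≤ 1 :=
  le_of_tendsto' (D.F_tendsto hx) (fun n => (D.Fn_bd n x hx).2)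

/-- exact equation when `f_i y` lies in the cell -/
lemma F_exact {i : ℕ} (h1 : 1 ≤ i) (h2 : i ≤ D.m) {y : ℝ} (hy : y ∈ Icc D.a D.b)
    (h4 : i < D.m → D.f i y < D.f (i+1) D.a) : D.F (D.f i y) = D.g i (D.F y) := by
  have e := D.idx_eq h1 h2 (D.fmono i h1 h2 hy.1) h4
  rw [D.F_eq (D.f_mem i h1 h2 hy), tau, e]
  have : (D.f i y - D.t i) / D.r i = y := by
    have := D.hr i h1 h2
    unfold f; field_simp; ring
  rw [this, min_eq_right hy.2]

lemma F_m {y : ℝ} (hy : y ∈ Icc D.a D.b) : D.F (D.f D.m y) = D.g D.m (D.F y) :=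
  D.F_exact (by have := D.hm; omega) le_rfl hy (by omega)

lemma F_b : D.F D.b = 1 := by
  have h := D.F_m (y := D.b) ⟨D.hab.le, le_rfl⟩
  rw [D.fmb, g] at h
  have h2 := D.cm
  change D.c D.m + D.p D.m = 1 at h2
  have h3 := D.hpq D.m (by have := D.hm; omega) le_rfl
  change D.p D.m ≤ _ at h3
  have h4 := D.hq
  have h5 : (D.F D.b - 1) * (1 - D.p D.m) = 0 := by rw [show D.c D.m = 1 - D.p D.m by linarith] at h; linarith
  rcases mul_eq_zero.1 h5 with h6 | h6 <;> linarith

lemma F_a : D.F D.a = 0 := by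
  have hm := D.hm
  have h := D.F_exact (i := 1) (y := D.a) le_rfl (by omega) ⟨le_rfl, D.hab.le⟩ (fun _ => D.lt 1 le_rfl (by omega))
  rw [D.f1a, g, D.c1] at h
  have h3 := D.hpq 1 le_rfl (by omega)
  change D.p 1 ≤ _ at h3
  have h4 := D.hq
  have h5 : (D.F D.a) * (1 - D.p 1) = 0 := by linarith
  rcases mul_eq_zero.1 h5 with h6 | h6 <;> linarith

lemma F_fa {i : ℕ} (h1 : 1 ≤ i) (h2 : i ≤ D.m) : D.F (D.f i D.a) = D.c i := by
  rw [D.F_exact h1 h2 ⟨le_rfl, D.hab.le⟩ (fun h => D.lt i h1 h), F_a, g]; ring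

lemma iter_mem {i : ℕ} (h1 : 1 ≤ i) (h2 : i ≤ D.m) {y : ℝ} (hy : y ∈ Icc D.a D.b) (n : ℕ) :
    (D.f i)^[n] y ∈ Icc D.a D.b := by
  induction n with
  | zero => exact hy
  | succ n ih => rw [Function.iterate_succ_apply']; exact D.f_mem i h1 h2 ih

lemma F_m_iter {y : ℝ} (hy : y ∈ Icc D.a D.b) (n : ℕ) :
    D.F ((D.f D.m)^[n] y) = 1 - D.p D.m ^ n + D.p D.m ^ n * D.F y := by
  induction n with
  | zero => simp
  | succ n ih =>
    rw [Function.iterate_succ_apply', D.F_m (D.iter_mem (by have := D.hm; omega) le_rfl hy n), ih, g]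
    have h2 := D.cm
    change D.c D.m + D.p D.m = 1 at h2
    rw [show D.c D.m = 1 - D.p D.m by linarith, pow_succ]; ring

lemma hDf {i : ℕ} (h1 : 1 ≤ i) (h2 : i < D.m) (h : D.ov i) (z : ℝ) :
    D.f i ((D.f D.m)^[D.u i] z) = D.f (i+1) ((D.f 1)^[D.v i] z) := D.hD i h1 h2 h z

lemma iter_f1_a (n : ℕ) : (D.f 1)^[n] D.a = D.a := Function.iterate_fixed D.f1a n
lemma iter_fm_b (n : ℕ) : (D.f D.m)^[n] D.b = D.b := Function.iterate_fixed D.fmb n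

lemma f1_lt_fm {x y : ℝ} (hx : x ∈ Icc D.a D.b) (hy : y ∈ Icc D.a D.b) : D.f 1 x < D.f D.m y := by
  have hm := D.hm
  have h5 : D.f 1 D.b < D.f 3 D.a := D.hB 1 le_rfl D.hm
  have h6 : D.f 3 D.a ≤ D.f D.m D.a := D.fa_mono (by omega) D.hm le_rfl
  have h7 := D.fmono D.m (by omega) le_rfl hy.1
  have h8 := D.fmono 1 le_rfl (by omega) hx.2
  linarith

/-- if `f_i y` is past the cell then `y` is in `f_m^u(I)` -/
lemma exists_pre {i : ℕ} (h1 : 1 ≤ i) (h2 : i < D.m) {y : ℝ} (hy : y ∈ Icc D.a D.b)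
    (h : D.f (i+1) D.a ≤ D.f i y) : D.ov i ∧ ∃ z ∈ Icc D.a D.b, y = (D.f D.m)^[D.u i] z := by
  have hov : D.ov i := by
    by_contra h3
    have h4 : D.f i D.b < D.f (i+1) D.a := D.hgap i h1 h2 h3
    have := D.fmono i h1 h2.le hy.2
    linarith
  refine ⟨hov, ?_⟩
  have e := D.hDf h1 h2 hov D.a
  rw [D.iter_f1_a] at e
  rw [← e] at h
  have h3 : (D.f D.m)^[D.u i] D.a ≤ y := by
    by_contra h4
    push Not at h4
    have := D.flt i h1 h2.le h4
    linarith
  have hc : Continuous ((D.f D.m)^[D.u i]) := by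
    apply Continuous.iterate; unfold f; fun_prop
  have := intermediate_value_Icc D.hab.le hc.continuousOn
  rw [D.iter_fm_b] at this
  obtain ⟨z, hz, e⟩ := this ⟨h3, hy.2⟩
  exact ⟨z, hz, e.symm⟩

lemma F_f1_iter {z : ℝ} (hz : z ∈ Icc D.a D.b) (n : ℕ) :
    D.F ((D.f 1)^[n+1] z) = D.p 1 ^ n * D.F (D.f 1 z) := by
  have hm := D.hm
  induction n with
  | zero => simp
  | succ n ih =>
    rw [Function.iterate_succ_apply', D.F_exact le_rfl (by omega) (D.iter_mem le_rfl (by omega) hz _), ih, g, D.c1]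
    · ring
    · intro h
      by_contra h3
      push Not at h3
      obtain ⟨h4, w, hw, e⟩ := D.exists_pre le_rfl (by omega) (D.iter_mem le_rfl (by omega) hz (n+1)) h3
      have := D.hu 1 le_rfl (by omega) h4
      obtain ⟨k, hk⟩ : ∃ k, D.u 1 = k+1 := ⟨D.u 1 - 1, by omega⟩
      rw [hk, Function.iterate_succ_apply', Function.iterate_succ_apply'] at e
      have := D.f1_lt_fm (D.iter_mem le_rfl (by omega) hz n) (D.iter_mem (by omega) le_rfl hw k)
      linarith

/-- combined: reduction on overlap -/
lemma F_red {i : ℕ} (h1 : 1 ≤ i) (h2 : i < D.m) (hov : D.ov i) {z : ℝ} (hz : z ∈ Icc D.a D.b) :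
    D.F (D.f i ((D.f D.m)^[D.u i] z)) = D.c (i+1) + D.p (i+1) * D.p 1 ^ (D.v i - 1) * D.F (D.f 1 z) := by
  have hm := D.hm
  have := D.hv i h1 h2 hov
  obtain ⟨k, hk⟩ : ∃ k, D.v i = k+1 := ⟨D.v i - 1, by omega⟩
  rw [D.hDf h1 h2 hov, D.F_exact (by omega) (by omega) (D.iter_mem le_rfl (by omega) hz _), hk, D.F_f1_iter hz, g]
  · simp; ring
  · intro h
    have h3 := D.f_mem 1 le_rfl (by omega) (D.iter_mem le_rfl (by omega) hz k)
    rw [hk, Function.iterate_succ_apply']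
    by_contra h4
    push Not at h4
    obtain ⟨h4, w, hw, e⟩ := D.exists_pre (by omega) (by omega) h3 h4
    have := D.hu (i+1) (by omega) (by omega) h4
    obtain ⟨k', hk'⟩ : ∃ k, D.u (i+1) = k+1 := ⟨D.u (i+1) - 1, by omega⟩
    rw [hk', Function.iterate_succ_apply'] at e
    have := D.f1_lt_fm (D.iter_mem le_rfl (by omega) hz k) (D.iter_mem (by omega) le_rfl hw k')
    linarith

lemma c_ov {i : ℕ} (h1 : 1 ≤ i) (h2 : i < D.m) (hov : D.ov i) :
    D.c (i+1) = D.c i + D.p i - D.p i * D.p D.m ^ D.u i := D.cov i h1 h2 hov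

lemma F_1 {z : ℝ} (hz : z ∈ Icc D.a D.b) : D.F (D.f 1 z) = D.p 1 * D.F z := by
  have hm := D.hm
  have hq0 := D.q_pos
  have key : ∀ n : ℕ, ∀ z ∈ Icc D.a D.b, |D.F (D.f 1 z) - D.p 1 * D.F z| ≤ D.q ^ n := by
    intro n
    induction n with
    | zero =>
      intro z hz
      have h1 := D.F_nonneg hz
      have h2 := D.F_le hz
      have h3 := D.F_nonneg (D.f_mem 1 le_rfl (by omega) hz)
      have h4 := D.F_le (D.f_mem 1 le_rfl (by omega) hz)
      have h5 := D.p_pos 1 le_rfl (by omega)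
      have h6 : D.p 1 ≤ 1 := (D.hpq 1 le_rfl (by omega)).trans D.hq.le
      rw [abs_le]; constructor <;> nlinarith
    | succ n ih =>
      intro z hz
      by_cases h : D.f 1 z < D.f (1+1) D.a
      · rw [D.F_exact le_rfl (by omega) hz (fun _ => h), g, D.c1]
        simp; positivity
      · push Not at h
        obtain ⟨hov, w, hw, rfl⟩ := D.exists_pre le_rfl (by omega) hz h
        rw [D.F_red le_rfl (by omega) hov hw, D.F_m_iter hw, D.c_ov le_rfl (by omega) hov, D.c1]
        have e := D.p_ov 1 le_rfl (by omega) hov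
        obtain ⟨k, hk⟩ : ∃ k, D.v 1 = k+1 := ⟨D.v 1 - 1, by have := D.hv 1 le_rfl (by omega) hov; omega⟩
        have h5 := D.p_pos 1 le_rfl (by omega)
        have h5' := D.p_pos 2 (by omega) (by omega)
        have h6 : D.p 1 ≤ 1 := (D.hpq 1 le_rfl (by omega)).trans D.hq.le
        have h7 : D.p 2 ≤ D.q := D.hpq 2 (by omega) (by omega)
        rw [hk] at e ⊢
        simp only [Nat.add_sub_cancel, Nat.reduceAdd] at e ⊢
        rw [show 0 + D.p 1 - D.p 1 * D.p D.m ^ D.u 1 + D.p 2 * D.p 1 ^ k * D.F (D.f 1 w) - D.p 1 * (1 - D.p D.m ^ D.u 1 + D.p D.m ^ D.u 1 * D.F w)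
          = D.p 2 * D.p 1 ^ k * (D.F (D.f 1 w) - D.p 1 * D.F w) by rw [pow_succ] at e; linear_combination (-D.F w) * e]
        rw [abs_mul, abs_of_pos (by positivity), pow_succ, mul_comm (D.q ^ n)]
        have : D.p 1 ^ k ≤ 1 := pow_le_one₀ h5.le h6
        gcongr
        · nlinarith
        · exact ih w hw
  have h0 : Tendsto (fun n => D.q ^ n) atTop (nhds 0) := tendsto_pow_atTop_nhds_zero_of_lt_one hq0.le D.hq
  have := ge_of_tendsto' h0 (fun n => key n z hz)
  have := abs_nonpos_iff.1 this
  linarith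

lemma F_f {i : ℕ} (h1 : 1 ≤ i) (h2 : i ≤ D.m) {z : ℝ} (hz : z ∈ Icc D.a D.b) : D.F (D.f i z) = D.g i (D.F z) := by
  by_cases h : i < D.m → D.f i z < D.f (i+1) D.a
  · exact D.F_exact h1 h2 hz h
  · push Not at h
    obtain ⟨h3, h⟩ := h
    obtain ⟨hov, w, hw, rfl⟩ := D.exists_pre h1 h3 hz h
    have e := D.p_ov i h1 h3 hov
    obtain ⟨k, hk⟩ : ∃ k, D.v i = k+1 := ⟨D.v i - 1, by have := D.hv i h1 h3 hov; omega⟩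
    rw [D.F_red h1 h3 hov hw, D.F_m_iter hw, D.c_ov h1 h3 hov, D.F_1 hw, g]
    rw [hk, pow_succ] at e
    rw [hk]; simp only [Nat.add_sub_cancel]
    linear_combination (-D.F w) * e

end
end Dat
lemma exists_delta (m : ℕ) (h : ℕ → ℝ) (hh : ∀ i, 1 ≤ i → i < m → 0 < h i) :
    ∃ δ > 0, ∀ i, 1 ≤ i → i < m → δ ≤ h i := by
  induction m with
  | zero => exact ⟨1, one_pos, fun i _ h => by omega⟩
  | succ n ih =>
    obtain ⟨δ, h1, h2⟩ := ih (fun i h1 h2 => hh i h1 (by omega))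
    by_cases hn : 1 ≤ n
    · refine ⟨min δ (h n), lt_min h1 (hh n hn (by omega)), fun i h3 h4 => ?_⟩
      rcases Nat.lt_succ_iff_lt_or_eq.1 h4 with h5 | rfl
      · exact (min_le_left _ _).trans (h2 i h3 h5)
      · exact min_le_right _ _
    · exact ⟨δ, h1, fun i h3 h4 => by omega⟩

namespace Dat
noncomputable section
variable (D : Dat)

lemma tau_mono {x y : ℝ} (hx : x ∈ Icc D.a D.b) (hxy : x ≤ y) (e : D.idx x = D.idx y) :
    D.tau x ≤ D.tau y ∧ D.tau y - D.tau x ≤ (y - x) / D.r (D.idx x) := by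
  have h := D.idx_spec hx
  have hr := D.hr _ h.1 (D.idx_le x)
  unfold tau
  rw [← e]
  have h1 : (x - D.t (D.idx x)) / D.r (D.idx x) ≤ (y - D.t (D.idx x)) / D.r (D.idx x) := by gcongr
  have h2 : (y - x) / D.r (D.idx x) = (y - D.t (D.idx x)) / D.r (D.idx x) - (x - D.t (D.idx x)) / D.r (D.idx x) := by ring
  refine ⟨min_le_min le_rfl h1, ?_⟩
  rw [h2]
  rcases min_cases D.b ((x - D.t (D.idx x)) / D.r (D.idx x)) with h3 | h3 <;>
  rcases min_cases D.b ((y - D.t (D.idx x)) / D.r (D.idx x)) with h4 | h4 <;> linarith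

lemma idx_mono {x y : ℝ} (hx : x ∈ Icc D.a D.b) (hy : y ∈ Icc D.a D.b) (hxy : x ≤ y) : D.idx x ≤ D.idx y := by
  by_contra h
  push Not at h
  have h1 := D.lt_of_idx_lt h (D.idx_le x)
  have h2 := (D.idx_spec hx).2
  linarith

lemma f_tau_le {x : ℝ} (hx : x ∈ Icc D.a D.b) : D.f (D.idx x) (D.tau x) ≤ x := by
  have h := D.idx_spec hx
  have hr := D.hr _ h.1 (D.idx_le x)
  have h1 : D.tau x ≤ (x - D.t (D.idx x)) / D.r (D.idx x) := min_le_right _ _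
  rw [le_div_iff₀ hr] at h1
  unfold f; linarith

lemma f_tau_eq {x : ℝ} (hx : x ∈ Icc D.a D.b) (h2 : x ≤ D.f (D.idx x) D.b) : D.f (D.idx x) (D.tau x) = x := by
  have h := D.idx_spec hx
  have hr := D.hr _ h.1 (D.idx_le x)
  unfold f at h2
  have h1 : D.tau x = (x - D.t (D.idx x)) / D.r (D.idx x) := min_eq_right (by rw [div_le_iff₀ hr]; linarith)
  rw [h1, f]; field_simp; ring

lemma tau_eq_b {x : ℝ} (hx : x ∈ Icc D.a D.b) (h2 : D.f (D.idx x) D.b ≤ x) : D.tau x = D.b := by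
  have h := D.idx_spec hx
  have hr := D.hr _ h.1 (D.idx_le x)
  unfold f at h2
  exact min_eq_left (by rw [le_div_iff₀ hr]; linarith)

lemma F_mono {x y : ℝ} (hx : x ∈ Icc D.a D.b) (hy : y ∈ Icc D.a D.b) (hxy : x ≤ y) : D.F x ≤ D.F y := by
  have hm := D.hm
  have hq0 := D.q_pos
  have key : ∀ n : ℕ, ∀ x ∈ Icc D.a D.b, ∀ y ∈ Icc D.a D.b, x ≤ y → D.F x - D.F y ≤ D.q ^ n := by
    intro n
    induction n with
    | zero =>
      intro x hx y hy hxy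
      have := D.F_le hx
      have := D.F_nonneg hy
      simp; linarith
    | succ n ih =>
      intro x hx y hy hxy
      have hi := D.idx_spec hx
      have hp := D.p_pos _ hi.1 (D.idx_le x)
      have hpq : D.p (D.idx x) ≤ D.q := D.hpq _ hi.1 (D.idx_le x)
      have hq : 0 ≤ D.q ^ n := by positivity
      rcases (D.idx_mono hx hy hxy).eq_or_lt with e | hlt
      · rw [D.F_eq hx, D.F_eq hy, ← e, g, g, pow_succ]
        have := ih _ (D.tau_mem hx) _ (D.tau_mem hy) (D.tau_mono hx hxy e).1
        nlinarith
      · have hy2 := D.idx_le y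
        have h3 : D.c (D.idx x + 1) ≤ D.F y := by
          rw [D.F_eq hy]
          have h4 := (D.c_mono (i := D.idx x + 1) (j := D.idx y) (by omega) (by omega) hy2).1
          have h5 := D.F_nonneg (D.tau_mem hy)
          have h6 := D.p_pos _ (by omega : 1 ≤ D.idx y) hy2
          unfold g; nlinarith
        rw [D.F_eq hx, g, pow_succ]
        by_cases hov : D.ov (D.idx x)
        · rw [D.c_ov hi.1 (by omega) hov] at h3
          have h7 := D.F_m_iter (y := D.a) ⟨le_rfl, D.hab.le⟩ (D.u (D.idx x))
          rw [D.F_a] at h7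
          have h8 : D.tau x ≤ (D.f D.m)^[D.u (D.idx x)] D.a := by
            by_contra h9
            push Not at h9
            have h10 := D.flt (D.idx x) hi.1 (D.idx_le x) h9
            rw [D.hDf hi.1 (by omega) hov, D.iter_f1_a] at h10
            have h11 := D.lt_of_idx_lt (x := x) (j := D.idx x + 1) (by omega) (by omega)
            have h12 := D.f_tau_le hx
            linarith
          have h9 := ih _ (D.tau_mem hx) _ (D.iter_mem (by omega) le_rfl ⟨le_rfl, D.hab.le⟩ _) h8
          rw [h7] at h9
          nlinarith
        · have := D.cgap _ hi.1 (by omega) hov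
          change _ = _ + D.p (D.idx x) at this
          have h4 := D.F_le (D.tau_mem hx)
          have : 0 ≤ D.q ^ n * D.q := by positivity
          nlinarith
  have h0 : Tendsto (fun n => D.q ^ n) atTop (nhds 0) := tendsto_pow_atTop_nhds_zero_of_lt_one hq0.le D.hq
  have := ge_of_tendsto' h0 (fun n => key n x hx y hy hxy)
  linarith

lemma holder_aux : ∃ C : ℝ, 0 < C ∧ ∀ x ∈ Icc D.a D.b, ∀ y ∈ Icc D.a D.b, x ≤ y → D.F y - D.F x ≤ C * (y - x) ^ D.s := by
  have hm := D.hm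
  have hq0 := D.q_pos
  have hs := D.hs
  obtain ⟨δ, hδ, hd⟩ := exists_delta D.m (fun i => min |D.f i D.b - D.f (i+1) D.a| (D.f (i+1) D.a - D.f i D.a)) (by
    intro i h1 h2
    refine lt_min ?_ (sub_pos.2 (D.lt i h1 h2))
    rw [abs_pos, sub_ne_zero]
    by_cases hov : D.ov i
    · have e := D.hDf h1 h2 hov D.a
      rw [D.iter_f1_a] at e
      rw [← e]
      apply ne_of_gt
      apply D.flt i h1 h2.le
      have : ∀ n, (D.f D.m)^[n] D.a < D.b := by
        intro n
        induction n with
        | zero => exact D.hab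
        | succ n ih =>
          rw [Function.iterate_succ_apply']
          have := D.flt D.m (by omega) le_rfl ih
          rwa [D.fmb] at this
      exact this _
    · exact (D.hgap i h1 h2 hov).ne)
  refine ⟨(δ ^ D.s)⁻¹, by positivity, ?_⟩
  have triv : ∀ x ∈ Icc D.a D.b, ∀ y ∈ Icc D.a D.b, δ ≤ y - x → D.F y - D.F x ≤ (δ ^ D.s)⁻¹ * (y - x) ^ D.s := by
    intro x hx y hy h
    have h1 := D.F_le hy
    have h2 := D.F_nonneg hx
    have h3 : δ ^ D.s ≤ (y - x) ^ D.s := Real.rpow_le_rpow hδ.le h hs.le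
    have h4 : 0 < δ ^ D.s := by positivity
    have : 1 ≤ (δ ^ D.s)⁻¹ * (y - x) ^ D.s := by
      rw [inv_mul_eq_div, one_le_div h4]; exact h3
    linarith
  generalize hC : (δ ^ D.s)⁻¹ = C at triv
  have hC0 : 0 < C := by rw [← hC]; positivity
  have key : ∀ n : ℕ, ∀ x ∈ Icc D.a D.b, ∀ y ∈ Icc D.a D.b, x ≤ y → D.F y - D.F x ≤ C * (y - x) ^ D.s + D.q ^ n := by
    intro n
    induction n with
    | zero =>
      intro x hx y hy hxy
      have := D.F_le hy
      have := D.F_nonneg hx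
      have : 0 ≤ C * (y - x) ^ D.s := mul_nonneg hC0.le (Real.rpow_nonneg (by linarith) _)
      simp; linarith
    | succ n ih =>
      -- scaling step
      have scale : ∀ i, 1 ≤ i → i ≤ D.m → ∀ x y x' y', x' ∈ Icc D.a D.b → y' ∈ Icc D.a D.b → x' ≤ y' → y' - x' ≤ (y - x) / D.r i →
          D.F x = D.g i (D.F x') → D.F y = D.g i (D.F y') →  D.F y - D.F x ≤ C * (y - x) ^ D.s + D.q ^ (n+1) := by
        intro i h1 h2 x y x' y' hx' hy' hxy hle ex ey
        have hp := D.p_pos i h1 h2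
        have hr := D.hr i h1 h2
        have hpq : D.p i ≤ D.q := D.hpq i h1 h2
        have h3 := ih x' hx' y' hy' hxy
        rw [ex, ey, g, g, pow_succ]
        have hyx : 0 ≤ y - x := by
          have : 0 ≤ (y - x) / D.r i := by linarith
          by_contra h
          push Not at h
          have := div_neg_of_neg_of_pos h hr
          linarith
        have h4 : D.p i * (y' - x') ^ D.s ≤ (y - x) ^ D.s := by
          have : (y' - x') ^ D.s ≤ ((y - x) / D.r i) ^ D.s := Real.rpow_le_rpow (by linarith) hle hs.le
          rw [Real.div_rpow hyx hr.le, le_div_iff₀ (show 0 < D.r i ^ D.s from hp)] at this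
          change _ * D.p i ≤ _ at this
          linarith
        have hq : 0 ≤ D.q ^ n := by positivity
        nlinarith
      intro x hx y hy hxy
      have hqn : 0 ≤ D.q ^ (n+1) := by positivity
      by_cases hbig : δ ≤ y - x
      · have := triv x hx y hy hbig; linarith
      push Not at hbig
      have same : ∀ x ∈ Icc D.a D.b, ∀ y ∈ Icc D.a D.b, x ≤ y → D.idx x = D.idx y → D.F y - D.F x ≤ C * (y - x) ^ D.s + D.q ^ (n+1) := by
        intro x hx y hy hxy e
        have h := D.tau_mono hx hxy e
        exact scale (D.idx x) (D.idx_spec hx).1 (D.idx_le x) x y _ _ (D.tau_mem hx) (D.tau_mem hy) h.1 h.2 (D.F_eq hx) (by rw [e]; exact D.F_eq hy)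
      rcases (D.idx_mono hx hy hxy).eq_or_lt with e | hlt
      · exact same x hx y hy hxy e
      have hi := D.idx_spec hx
      have hj := D.idx_spec hy
      have hy2 := D.idx_le y
      have hdi := hd _ hi.1 (by omega)
      have hd1 := hdi.trans (min_le_left _ _)
      have hx3 := D.lt_of_idx_lt (x := x) (j := D.idx x + 1) (by omega) (by omega)
      have hy3 := (D.fa_mono (i := D.idx x + 1) (j := D.idx y) (by omega) (by omega) hy2).trans hj.2
      have hr := D.hr _ hi.1 (D.idx_le x)
      by_cases hov : D.ov (D.idx x)
      · have hpos : D.f (D.idx x + 1) D.a ≤ D.f (D.idx x) D.b := by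
          have e := D.hDf hi.1 (by omega) hov D.a
          rw [D.iter_f1_a] at e
          rw [← e]
          exact D.fmono _ hi.1 (by omega) (D.iter_mem (by omega) le_rfl ⟨le_rfl, D.hab.le⟩ _).2
        rw [abs_of_nonneg (by linarith)] at hd1
        have ey : D.f (D.idx x) ((y - D.t (D.idx x)) / D.r (D.idx x)) = y := by
          unfold f; field_simp; ring
        have ex : D.tau x = (x - D.t (D.idx x)) / D.r (D.idx x) := by
          apply min_eq_right
          have : x ≤ D.f (D.idx x) D.b := by linarith
          rw [div_le_iff₀ hr]; unfold f at this; linarith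
        have hle : D.tau x ≤ ((y - D.t (D.idx x)) / D.r (D.idx x)) := by rw [ex]; gcongr
        have hy' : ((y - D.t (D.idx x)) / D.r (D.idx x)) ∈ Icc D.a D.b := by
          refine ⟨(D.tau_mem hx).1.trans hle, ?_⟩
          have : y ≤ D.f (D.idx x) D.b := by linarith
          rw [div_le_iff₀ hr]; unfold f at this; linarith
        refine scale (D.idx x) hi.1 (D.idx_le x) x y (D.tau x) _ (D.tau_mem hx) hy' hle ?_ (D.F_eq hx) ?_
        · rw [ex]; apply le_of_eq; ring
        · conv_lhs => rw [← ey]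
          exact D.F_f hi.1 (D.idx_le x) hy'
      · have hg : D.f (D.idx x) D.b < D.f (D.idx x + 1) D.a := D.hgap _ hi.1 (by omega) hov
        rw [abs_of_neg (by linarith)] at hd1
        have e1 : D.tau x = D.b := D.tau_eq_b hx (by linarith)
        have e2 : D.F x = D.F (D.f (D.idx x + 1) D.a) := by
          rw [D.F_fa (by omega) (by omega), D.F_eq hx, e1, D.F_b, g, D.cgap _ hi.1 (by omega) hov]
          unfold p; ring
        have hmem := D.f_mem (D.idx x + 1) (by omega) (by omega) (x := D.a) ⟨le_rfl, D.hab.le⟩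
        have e3 : D.idx (D.f (D.idx x + 1) D.a) = D.idx x + 1 :=
          D.idx_eq (by omega) (by omega) le_rfl (fun h => D.lt _ (by omega) h)
        have e4 : D.idx y = D.idx x + 1 := by
          refine D.idx_eq (by omega) (by omega) hy3 (fun h => ?_)
          have := (hd (D.idx x + 1) (by omega) h).trans (min_le_right _ _)
          linarith
        have h5 := same _ hmem y hy hy3 (e3.trans e4.symm)
        rw [e2]
        refine h5.trans ?_
        gcongr
  intro x hx y hy hxy
  have h0 : Tendsto (fun n => C * (y - x) ^ D.s + D.q ^ n) atTop (nhds (C * (y - x) ^ D.s + 0)) := (tendsto_pow_atTop_nhds_zero_of_lt_one hq0.le D.hq).const_add _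
  have := ge_of_tendsto' h0 (fun n => key n x hx y hy hxy)
  linarith

lemma holder : ∃ C : NNReal, HolderOnWith C D.s.toNNReal D.F (Icc D.a D.b) := by
  obtain ⟨C, hC, h⟩ := D.holder_aux
  refine ⟨C.toNNReal, ?_⟩
  have key : ∀ x ∈ Icc D.a D.b, ∀ y ∈ Icc D.a D.b, x ≤ y → edist (D.F x) (D.F y) ≤ ENNReal.ofReal C * edist x y ^ D.s := by
    intro x hx y hy hxy
    rw [edist_dist, edist_dist, ENNReal.ofReal_rpow_of_nonneg dist_nonneg D.hs.le, ← ENNReal.ofReal_mul hC.le]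
    apply ENNReal.ofReal_le_ofReal
    rw [dist_comm, dist_comm x, Real.dist_eq, Real.dist_eq, abs_of_nonneg (sub_nonneg.2 hxy), abs_of_nonneg (sub_nonneg.2 (D.F_mono hx hy hxy))]
    exact h x hx y hy hxy
  intro x hx y hy
  rw [Real.coe_toNNReal _ D.hs.le]
  change _ ≤ ENNReal.ofReal C * _
  rcases le_total x y with h1 | h1
  · exact key x hx y hy h1
  · rw [edist_comm, edist_comm x]; exact key y hy x hx h1

end
end Dat
namespace Dat
noncomputable section
variable (D : Dat)

def Valid (L : List ℕ) : Prop := ∀ i ∈ L, 1 ≤ i ∧ i ≤ D.m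
def rL (L : List ℕ) : ℝ := (L.map D.r).prod
def pL (L : List ℕ) : ℝ := (L.map D.p).prod

lemma valid_cons {i : ℕ} {L : List ℕ} : D.Valid (i :: L) ↔ (1 ≤ i ∧ i ≤ D.m) ∧ D.Valid L := by
  simp [Valid]

lemma valid_append {L L' : List ℕ} : D.Valid (L ++ L') ↔ D.Valid L ∧ D.Valid L' := by
  simp only [Valid, List.mem_append]
  constructor
  · intro h; exact ⟨fun i hi => h i (Or.inl hi), fun i hi => h i (Or.inr hi)⟩
  · rintro ⟨h1, h2⟩ i (hi | hi)
    · exact h1 i hi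
    · exact h2 i hi

lemma rL_pos {L : List ℕ} (h : D.Valid L) : 0 < D.rL L ∧ 0 < D.pL L ∧ D.rL L ≤ D.q ^ L.length ∧ D.pL L ≤ D.q ^ L.length
    ∧ D.rL L ^ D.s = D.pL L := by
  induction L with
  | nil => simp [rL, pL]
  | cons i L ih =>
    rw [valid_cons] at h
    obtain ⟨h1, h2, h3, h4, h5⟩ := ih h.2
    have hr := D.hr i h.1.1 h.1.2
    have hp := D.p_pos i h.1.1 h.1.2
    have hrq := D.hrq i h.1.1 h.1.2
    have hpq : D.p i ≤ D.q := D.hpq i h.1.1 h.1.2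
    have hq := D.q_pos
    have e1 : D.rL (i :: L) = D.r i * D.rL L := by simp [rL]
    have e2 : D.pL (i :: L) = D.p i * D.pL L := by simp [pL]
    rw [e1, e2, List.length_cons, pow_succ']
    refine ⟨by positivity, by positivity, by gcongr, by gcongr, ?_⟩
    rw [Real.mul_rpow hr.le h1.le, h5]; rfl

lemma pL_append (L L' : List ℕ) : D.pL (L ++ L') = D.pL L * D.pL L' := by simp [pL]

lemma foldr_f (L : List ℕ) (x : ℝ) : L.foldr D.f x = L.foldr D.f 0 + D.rL L * x := by
  induction L with
  | nil => simp [rL]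
  | cons i L ih =>
    have e1 : D.rL (i :: L) = D.r i * D.rL L := by simp [rL]
    rw [List.foldr_cons, List.foldr_cons, ih, e1, f, f]; ring

lemma foldr_g (L : List ℕ) (x : ℝ) : L.foldr D.g x = L.foldr D.g 0 + D.pL L * x := by
  induction L with
  | nil => simp [pL]
  | cons i L ih =>
    have e1 : D.pL (i :: L) = D.p i * D.pL L := by simp [pL]
    rw [List.foldr_cons, List.foldr_cons, ih, e1, g, g]; ring

lemma foldr_f_mem {L : List ℕ} (h : D.Valid L) {x : ℝ} (hx : x ∈ Icc D.a D.b) : L.foldr D.f x ∈ Icc D.a D.b := by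
  induction L with
  | nil => exact hx
  | cons i L ih =>
    rw [valid_cons] at h
    exact D.f_mem i h.1.1 h.1.2 (ih h.2)

lemma g_mem {i : ℕ} (h1 : 1 ≤ i) (h2 : i ≤ D.m) {y : ℝ} (hy : y ∈ Icc (0:ℝ) 1) : D.g i y ∈ Icc (0:ℝ) 1 := by
  have h3 := D.c_nonneg i h1 h2
  have h4 := D.cp_le i h1 h2
  have h5 := D.p_pos i h1 h2
  have := hy.1
  have := hy.2
  unfold g
  constructor
  · positivity
  · nlinarith

lemma foldr_g_mem {L : List ℕ} (h : D.Valid L) {x : ℝ} (hx : x ∈ Icc (0:ℝ) 1) : L.foldr D.g x ∈ Icc (0:ℝ) 1 := by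
  induction L with
  | nil => exact hx
  | cons i L ih =>
    rw [valid_cons] at h
    exact D.g_mem h.1.1 h.1.2 (ih h.2)

lemma F_foldr {L : List ℕ} (h : D.Valid L) {x : ℝ} (hx : x ∈ Icc D.a D.b) : D.F (L.foldr D.f x) = L.foldr D.g (D.F x) := by
  induction L with
  | nil => rfl
  | cons i L ih =>
    rw [valid_cons] at h
    rw [List.foldr_cons, List.foldr_cons, D.F_f h.1.1 h.1.2 (D.foldr_f_mem h.2 hx), ih h.2]

lemma upper (E : Set ℝ) (hE : E ⊆ Icc D.a D.b)
    (hE2 : ∀ x ∈ E, ∃ i, 1 ≤ i ∧ i ≤ D.m ∧ ∃ y ∈ E, x = D.f i y) : μH[D.s] E < ⊤ := by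
  have hword : ∀ n, ∀ x ∈ E, ∃ L, D.Valid L ∧ L.length = n ∧ ∃ y ∈ E, x = L.foldr D.f y := by
    intro n
    induction n with
    | zero => intro x hx; exact ⟨[], by simp [Valid], rfl, x, hx, rfl⟩
    | succ n ih =>
      intro x hx
      obtain ⟨i, h1, h2, y, hy, e⟩ := hE2 x hx
      obtain ⟨L, h3, h4, z, hz, e2⟩ := ih y hy
      exact ⟨i :: L, D.valid_cons.2 ⟨⟨h1, h2⟩, h3⟩, by simp [h4], z, hz, by rw [e, e2]; rfl⟩
  have hab := D.hab
  have hs := D.hs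
  have hball : ∀ L : List ℕ, Metric.closedBall (L.foldr D.f ((D.a + D.b)/2)) (D.rL L * ((D.b - D.a)/2)) = Icc (L.foldr D.f D.a) (L.foldr D.f D.b) := by
    intro L
    rw [Real.closedBall_eq_Icc, D.foldr_f L D.a, D.foldr_f L D.b, D.foldr_f L ((D.a + D.b)/2)]
    congr 1 <;> ring
  have hvit : ∀ n, ∃ u ⊆ {L : List ℕ | D.Valid L ∧ L.length = n},
      u.PairwiseDisjoint (fun L => Metric.closedBall (L.foldr D.f ((D.a + D.b)/2)) (D.rL L * ((D.b - D.a)/2))) ∧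
      ∀ L ∈ {L : List ℕ | D.Valid L ∧ L.length = n}, ∃ L' ∈ u,
       Metric.closedBall (L.foldr D.f ((D.a + D.b)/2)) (D.rL L * ((D.b - D.a)/2)) ⊆ Metric.closedBall (L'.foldr D.f ((D.a + D.b)/2)) (5 * (D.rL L' * ((D.b - D.a)/2))) := by
    intro n
    refine Vitali.exists_disjoint_subfamily_covering_enlargement_closedBall _ _ _ (D.q ^ n * ((D.b - D.a)/2)) ?_ 5 (by norm_num)
    rintro L ⟨h1, h2⟩
    have := (D.rL_pos h1).2.2.1
    rw [h2] at this
    have : 0 ≤ (D.b - D.a)/2 := by linarith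
    gcongr
  choose u hu1 hu2 hu3 using hvit
  set K : ℝ := 5 * (D.b - D.a) with hK
  have hK0 : 0 < K := by rw [hK]; linarith
  have hdiam : ∀ L : List ℕ, D.Valid L → Metric.ediam (Metric.closedBall (L.foldr D.f ((D.a + D.b)/2)) (5 * (D.rL L * ((D.b - D.a)/2)))) = ENNReal.ofReal (K * D.rL L) := by
    intro L hL
    rw [Real.closedBall_eq_Icc, Real.ediam_Icc]
    congr 1; rw [hK]; ring
  have hsum : ∀ n, ∑' L : u n, ENNReal.ofReal (D.pL L) ≤ 1 := by
    intro n
    have e : ∀ L : u n, ENNReal.ofReal (D.pL L) = volume (Ioo ((L:List ℕ).foldr D.g 0) ((L:List ℕ).foldr D.g 1)) := by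
      intro L
      rw [Real.volume_Ioo, D.foldr_g L 1]; congr 1; ring
    rw [tsum_congr e]
    have hdis : (u n).PairwiseDisjoint (fun L => Ioo (L.foldr D.g 0) (L.foldr D.g 1)) := by
      have aux : ∀ L ∈ u n, ∀ L' ∈ u n, L.foldr D.f D.b < L'.foldr D.f D.a → L.foldr D.g 1 ≤ L'.foldr D.g 0 := by
        intro L hL L' hL' h
        have h1 := (hu1 n hL).1
        have h2 := (hu1 n hL').1
        rw [← D.F_b, ← D.F_a, ← D.F_foldr h1 ⟨hab.le, le_rfl⟩, ← D.F_foldr h2 ⟨le_rfl, hab.le⟩]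
        exact D.F_mono (D.foldr_f_mem h1 ⟨hab.le, le_rfl⟩) (D.foldr_f_mem h2 ⟨le_rfl, hab.le⟩) h.le
      intro L hL L' hL' hne
      have hd := hu2 n hL hL' hne
      simp only [Function.onFun, hball] at hd ⊢
      rw [Set.disjoint_left] at hd ⊢
      have h1 := (D.rL_pos (hu1 n hL).1).1
      have h2 := (D.rL_pos (hu1 n hL').1).1
      have e1 := D.foldr_f L D.a
      have e2 := D.foldr_f L D.b
      have e3 := D.foldr_f L' D.a
      have e4 := D.foldr_f L' D.b
      have h5 : L.foldr D.f D.a ≤ L.foldr D.f D.b := by rw [e1, e2]; gcongr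
      have h6 : L'.foldr D.f D.a ≤ L'.foldr D.f D.b := by rw [e3, e4]; gcongr
      rcases le_total (L.foldr D.f D.a) (L'.foldr D.f D.a) with h7 | h7
      · have h8 : L.foldr D.f D.b < L'.foldr D.f D.a := by
          by_contra h9
          exact hd (a := L'.foldr D.f D.a) ⟨h7, not_lt.1 h9⟩ ⟨le_rfl, h6⟩
        have := aux L hL L' hL' h8
        rintro x ⟨_, hx⟩ ⟨hx2, _⟩
        linarith
      · have h8 : L'.foldr D.f D.b < L.foldr D.f D.a := by
          by_contra h9
          exact hd (a := L.foldr D.f D.a) ⟨le_rfl, h5⟩ ⟨h7, not_lt.1 h9⟩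
        have := aux L' hL' L hL h8
        rintro x ⟨hx2, hx⟩ ⟨_, _⟩
        linarith
    rw [← measure_biUnion (Set.to_countable _) hdis (fun _ _ => measurableSet_Ioo)]
    calc _ ≤ volume (Icc (0:ℝ) 1) := by
          apply measure_mono
          apply iUnion₂_subset
          intro L hL
          have h1 := (hu1 n hL).1
          have h2 := D.foldr_g_mem h1 (x := 0) ⟨le_rfl, zero_le_one⟩
          have h3 := D.foldr_g_mem h1 (x := 1) ⟨zero_le_one, le_rfl⟩
          exact fun x hx => ⟨h2.1.trans hx.1.le, hx.2.le.trans h3.2⟩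
      _ = 1 := by simp
  have hmain := Measure.hausdorffMeasure_le_liminf_tsum (β := ℕ) (ι := fun n => u n) D.s E (l := atTop)
    (fun n => ENNReal.ofReal (K * D.q ^ n)) ?_
    (fun n L => Metric.closedBall ((L:List ℕ).foldr D.f ((D.a + D.b)/2)) (5 * (D.rL L * ((D.b - D.a)/2)))) ?_ ?_
  · refine lt_of_le_of_lt hmain ?_
    have : ∀ n, ∑' L : u n, Metric.ediam (Metric.closedBall ((L:List ℕ).foldr D.f ((D.a + D.b)/2)) (5 * (D.rL L * ((D.b - D.a)/2)))) ^ D.s ≤ ENNReal.ofReal (K ^ D.s) := by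
      intro n
      have e : ∀ L : u n, Metric.ediam (Metric.closedBall ((L:List ℕ).foldr D.f ((D.a + D.b)/2)) (5 * (D.rL L * ((D.b - D.a)/2)))) ^ D.s = ENNReal.ofReal (K ^ D.s) * ENNReal.ofReal (D.pL L) := by
        intro L
        have hL := D.rL_pos (hu1 n L.2).1
        have := hL.1
        rw [hdiam _ (hu1 n L.2).1, ENNReal.ofReal_rpow_of_nonneg (by positivity) hs.le, Real.mul_rpow hK0.le this.le, hL.2.2.2.2, ENNReal.ofReal_mul (by positivity)]
      rw [tsum_congr e, ENNReal.tsum_mul_left]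
      calc _ ≤ ENNReal.ofReal (K ^ D.s) * 1 := by gcongr; exact hsum n
        _ = _ := mul_one _
    calc _ ≤ liminf (fun n : ℕ => ENNReal.ofReal (K ^ D.s)) atTop := liminf_le_liminf (Eventually.of_forall this)
      _ = ENNReal.ofReal (K ^ D.s) := by simp
      _ < ⊤ := ENNReal.ofReal_lt_top
  · rw [← ENNReal.ofReal_zero]
    apply ENNReal.tendsto_ofReal
    simpa using (tendsto_pow_atTop_nhds_zero_of_lt_one D.q_pos.le D.hq).const_mul K
  · refine Eventually.of_forall fun n L => ?_
    rw [hdiam _ (hu1 n L.2).1]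
    have := (D.rL_pos (hu1 n L.2).1).2.2.1
    rw [(hu1 n L.2).2] at this
    apply ENNReal.ofReal_le_ofReal
    gcongr
  · refine Eventually.of_forall fun n x hx => ?_
    obtain ⟨L, h1, h2, y, hy, e⟩ := hword n x hx
    obtain ⟨L', h3, h4⟩ := hu3 n L ⟨h1, h2⟩
    refine mem_iUnion.2 ⟨⟨L', h3⟩, h4 ?_⟩
    rw [hball, e]
    have hp := (D.rL_pos h1).1
    have := hE hy
    rw [D.foldr_f L y, D.foldr_f L D.a, D.foldr_f L D.b]
    constructor
    · have := this.1; gcongr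
    · have := this.2; gcongr

lemma g_cover {y : ℝ} (hy : y ∈ Icc (0:ℝ) 1) : ∃ i, 1 ≤ i ∧ i ≤ D.m ∧ ∃ z ∈ Icc (0:ℝ) 1, y = D.g i z := by
  have key : ∀ k, 1 ≤ k → k ≤ D.m → y ≤ D.c k + D.p k → ∃ i, 1 ≤ i ∧ i ≤ D.m ∧ D.c i ≤ y ∧ y ≤ D.c i + D.p i := by
    intro k hk
    induction k, hk using Nat.le_induction with
    | base => intro h1 h2; exact ⟨1, le_rfl, h1, by rw [D.c1]; exact hy.1, h2⟩
    | succ k hk ih =>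
      intro h1 h2
      by_cases h : D.c (k+1) ≤ y
      · exact ⟨k+1, by omega, h1, h, h2⟩
      · exact ih (by omega) (by have := (D.c_step k hk (by omega)).2.1; linarith)
  have hm := D.hm
  obtain ⟨i, h1, h2, h3, h4⟩ := key D.m (by omega) le_rfl (by
    have h := D.cm
    change D.c D.m + D.p D.m = 1 at h
    rw [h]; exact hy.2)
  have hp := D.p_pos i h1 h2
  refine ⟨i, h1, h2, (y - D.c i) / D.p i, ⟨div_nonneg (by linarith) hp.le, by rw [div_le_one hp]; linarith⟩, ?_⟩
  unfold g; field_simp; ring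

lemma g_word (n : ℕ) : ∀ y ∈ Icc (0:ℝ) 1, ∃ L, D.Valid L ∧ L.length = n ∧ ∃ z ∈ Icc (0:ℝ) 1, y = L.foldr D.g z := by
  induction n with
  | zero => intro x hx; exact ⟨[], by simp [Valid], rfl, x, hx, rfl⟩
  | succ n ih =>
    intro x hx
    obtain ⟨i, h1, h2, y, hy, e⟩ := D.g_cover hx
    obtain ⟨L, h3, h4, z, hz, e2⟩ := ih y hy
    exact ⟨i :: L, D.valid_cons.2 ⟨⟨h1, h2⟩, h3⟩, by simp [h4], z, hz, by rw [e, e2]; rfl⟩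

lemma g_image {L : List ℕ} (h : D.Valid L) : L.foldr D.g '' Icc (0:ℝ) 1 = Icc (L.foldr D.g 0) (L.foldr D.g 0 + D.pL L) := by
  have hp := (D.rL_pos h).2.1
  ext x
  constructor
  · rintro ⟨y, hy, rfl⟩
    show L.foldr D.g y ∈ _
    rw [D.foldr_g L y]
    have := hy.1
    have := hy.2
    constructor <;> nlinarith
  · rintro ⟨h1, h2⟩
    refine ⟨(x - L.foldr D.g 0) / D.pL L, ⟨div_nonneg (by linarith) hp.le, by rw [div_le_one hp]; linarith⟩, ?_⟩
    show L.foldr D.g _ = _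
    rw [D.foldr_g]; field_simp; ring

def V (w : List ℕ) : Set ℝ := Icc (0:ℝ) 1 \ ⋃ L ∈ {L | D.Valid L}, (fun y => (L ++ w).foldr D.g y) '' Icc (0:ℝ) 1

lemma V_null {w : List ℕ} (hw : D.Valid w) : volume (D.V w) = 0 := by
  have h := Besicovitch.ae_tendsto_measure_inter_div (volume : Measure ℝ) (D.V w)
  have hwp := (D.rL_pos hw).2.1
  have hmeas : MeasurableSet (D.V w) := by
    refine measurableSet_Icc.diff (MeasurableSet.biUnion (Set.to_countable _) fun L hL => ?_)
    have := D.g_image (D.valid_append.2 ⟨hL, hw⟩)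
    rw [show (fun y => (L ++ w).foldr D.g y) = (L ++ w).foldr D.g from rfl, this]
    exact measurableSet_Icc
  rw [ae_restrict_iff' hmeas] at h
  have h2 : ∀ᵐ x ∂(volume : Measure ℝ), x ∉ D.V w := by
    filter_upwards [h] with x hx hxV
    have hx := hx hxV
    have hwd : ∀ n, ∃ L, D.Valid L ∧ L.length = n ∧ ∃ z ∈ Icc (0:ℝ) 1, x = L.foldr D.g z := fun n => D.g_word n x hxV.1
    choose L hL1 hL2 z hz e using hwd
    have hlim : Tendsto (fun n => D.pL (L n)) atTop (nhdsWithin 0 (Ioi 0)) := by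
      rw [tendsto_nhdsWithin_iff]
      refine ⟨?_, Eventually.of_forall fun n => (D.rL_pos (hL1 n)).2.1⟩
      refine squeeze_zero (fun n => (D.rL_pos (hL1 n)).2.1.le) (fun n => ?_) (tendsto_pow_atTop_nhds_zero_of_lt_one D.q_pos.le D.hq)
      have := (D.rL_pos (hL1 n)).2.2.2.1
      rwa [hL2] at this
    have h3 := hx.comp hlim
    have h4 : (1:ENNReal) ≤ ENNReal.ofReal (1 - D.pL w / 2) := by
      refine le_of_tendsto' h3 fun n => ?_
      have hp := (D.rL_pos (hL1 n)).2.1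
      have hval := D.valid_append.2 ⟨hL1 n, hw⟩
      have hpw1 : D.pL w ≤ 1 := (D.rL_pos hw).2.2.2.1.trans (pow_le_one₀ D.q_pos.le D.hq.le)
      simp only [Function.comp]
      apply ENNReal.div_le_of_le_mul
      have hsub : D.V w ∩ Metric.closedBall x (D.pL (L n)) ⊆ Metric.closedBall x (D.pL (L n)) \ ((L n ++ w).foldr D.g '' Icc (0:ℝ) 1) := by
        rintro y ⟨hy1, hy2⟩
        refine ⟨hy2, fun hy3 => hy1.2 ?_⟩
        exact mem_biUnion (show L n ∈ {L | D.Valid L} from hL1 n) hy3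
      have hin : (L n ++ w).foldr D.g '' Icc (0:ℝ) 1 ⊆ Metric.closedBall x (D.pL (L n)) := by
        rintro _ ⟨y, hy, rfl⟩
        beta_reduce
        rw [List.foldr_append, Metric.mem_closedBall, Real.dist_eq, e n, D.foldr_g (L n) (z n), D.foldr_g (L n) (w.foldr D.g y)]
        have hy' := D.foldr_g_mem hw hy
        have hz' := hz n
        rw [abs_le]
        have := hy'.1
        have := hy'.2
        have := hz'.1
        have := hz'.2
        constructor <;> nlinarith
      have hvol : volume ((L n ++ w).foldr D.g '' Icc (0:ℝ) 1) = ENNReal.ofReal (D.pL (L n) * D.pL w) := by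
        rw [D.g_image hval, Real.volume_Icc, D.pL_append]; congr 1; ring
      calc _ ≤ _ := measure_mono hsub
        _ = ENNReal.ofReal (2 * D.pL (L n)) - ENNReal.ofReal (D.pL (L n) * D.pL w) := by
          rw [measure_sdiff hin _ (by rw [hvol]; exact ENNReal.ofReal_ne_top), hvol, Real.volume_closedBall]
          rw [D.g_image hval]; exact measurableSet_Icc.nullMeasurableSet
        _ = ENNReal.ofReal ((1 - D.pL w / 2) * (2 * D.pL (L n))) := by
          rw [← ENNReal.ofReal_sub _ (by positivity)]; congr 1; ring
        _ = _ := by rw [Real.volume_closedBall, ENNReal.ofReal_mul (by linarith)]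
    rw [ENNReal.one_le_ofReal] at h4
    linarith
  rw [ae_iff] at h2
  simpa using h2

def Good (w : List ℕ) : Set ℝ := {y | y ∈ Icc (0:ℝ) 1 ∧ ∀ L, D.Valid L → y ∉ L.foldr D.g '' D.V w}

lemma Good_vol {w : List ℕ} (hw : D.Valid w) : volume (D.Good w) ≠ 0 := by
  intro h0
  have hsub : Icc (0:ℝ) 1 ⊆ D.Good w ∪ ⋃ L ∈ {L | D.Valid L}, L.foldr D.g '' D.V w := by
    intro y hy
    by_cases h : y ∈ D.Good w
    · exact Or.inl h
    · right
      have : ¬ ∀ L, D.Valid L → y ∉ L.foldr D.g '' D.V w := fun h' => h ⟨hy, h'⟩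
      push Not at this
      obtain ⟨L, h1, h2⟩ := this
      exact mem_biUnion (show L ∈ {L | D.Valid L} from h1) h2
  have hnull : volume (⋃ L ∈ {L | D.Valid L}, L.foldr D.g '' D.V w) = 0 := by
    rw [measure_biUnion_null_iff (Set.to_countable _)]
    intro L hL
    apply addHaar_image_eq_zero_of_differentiableOn_of_addHaar_eq_zero _ _ (D.V_null hw)
    have : (fun y => L.foldr D.g y) = fun y => L.foldr D.g 0 + D.pL L * y := funext (D.foldr_g L)
    rw [show L.foldr D.g = (fun y => L.foldr D.g y) from rfl, this]
    fun_prop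
  have := (measure_mono hsub).trans (measure_union_le (μ := volume) _ _)
  rw [h0, hnull] at this
  simp at this

lemma Good_step {w : List ℕ} (hw : D.Valid w) {y : ℝ} (hy : y ∈ D.Good w) : ∃ L, D.Valid L ∧ ∃ z ∈ D.Good w, y = (L ++ w).foldr D.g z := by
  have h1 : y ∉ D.V w := fun h => hy.2 [] (by simp [Valid]) ⟨y, h, rfl⟩
  have h2 : y ∈ ⋃ L ∈ {L | D.Valid L}, (fun y => (L ++ w).foldr D.g y) '' Icc (0:ℝ) 1 := by
    by_contra h; exact h1 ⟨hy.1, h⟩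
  simp only [mem_iUnion] at h2
  obtain ⟨L, hL, z, hz, e⟩ := h2
  refine ⟨L, hL, z, ⟨hz, fun L' hL' ⟨x, hx, e2⟩ => ?_⟩, e.symm⟩
  refine hy.2 (L ++ w ++ L') (D.valid_append.2 ⟨D.valid_append.2 ⟨hL, hw⟩, hL'⟩) ⟨x, hx, ?_⟩
  beta_reduce at e2 ⊢
  rw [List.foldr_append, e2]; exact e

end
end Dat
def PP (σ : ℕ → List ℕ) (w w' : List ℕ) (ε : ℕ → Bool) : ℕ → List ℕ
  | 0 => []
  | n+1 => PP σ w w' ε n ++ (σ n ++ (if ε n then w else w'))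

def dd (σ : ℕ → List ℕ) (w w' : List ℕ) (ε : ℕ → Bool) (k : ℕ) : ℕ := (PP σ w w' ε (k+1)).getD k 0

section
variable (σ : ℕ → List ℕ) (w w' : List ℕ) (ε : ℕ → Bool)

lemma PP_prefix {n n' : ℕ} (h : n ≤ n') : PP σ w w' ε n <+: PP σ w w' ε n' := by
  induction n', h using Nat.le_induction with
  | base => exact List.prefix_rfl
  | succ k hk ih => exact ih.trans (List.prefix_append _ _)

lemma PP_len (hw : w ≠ []) (hw' : w' ≠ []) (n : ℕ) : n ≤ (PP σ w w' ε n).length := by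
  induction n with
  | zero => omega
  | succ n ih =>
    have h1 := List.length_pos_iff.2 hw
    have h2 := List.length_pos_iff.2 hw'
    rw [PP, List.length_append, List.length_append]
    split <;> omega

lemma getD_prefix {A B : List ℕ} (h : A <+: B) {k : ℕ} (hk : k < A.length) : B.getD k 0 = A.getD k 0 := by
  obtain ⟨C, rfl⟩ := h
  rw [List.getD_append _ _ _ _ hk]

lemma dd_eq (hw : w ≠ []) (hw' : w' ≠ []) {n k : ℕ} (hk : k < (PP σ w w' ε n).length) :
    dd σ w w' ε k = (PP σ w w' ε n).getD k 0 := by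
  unfold dd
  rcases le_total n (k+1) with h | h
  · exact getD_prefix (PP_prefix σ w w' ε h) hk
  · exact (getD_prefix (PP_prefix σ w w' ε h) (PP_len σ w w' ε hw hw' (k+1))).symm

lemma dd_range (hw : w ≠ []) (hw' : w' ≠ []) (n : ℕ) :
    (List.range (PP σ w w' ε n).length).map (dd σ w w' ε) = PP σ w w' ε n := by
  apply List.ext_getElem
  · simp
  · intro k h1 h2
    rw [List.getElem_map, List.getElem_range, dd_eq σ w w' ε hw hw' h2, List.getD_eq_getElem _ _ h2]

lemma PP_congr {ε' : ℕ → Bool} (n : ℕ) (h : ∀ k < n, ε k = ε' k) : PP σ w w' ε n = PP σ w w' ε' n := by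
  induction n with
  | zero => rfl
  | succ n ih => rw [PP, PP, ih (fun k hk => h k (by omega)), h n (by omega)]

lemma dd_inj (j j' : ℕ) (w0 w0' : List ℕ) (hj : j ≠ j') : Function.Injective (dd σ (j :: w0) (j' :: w0')) := by
  intro ε ε' h
  by_contra hne
  have hex : ∃ n, ε n ≠ ε' n := by
    by_contra h2; push Not at h2; exact hne (funext h2)
  classical
  set n := Nat.find hex with hn
  have h1 : ε n ≠ ε' n := Nat.find_spec hex
  have h2 : ∀ k < n, ε k = ε' k := fun k hk => by
    have := Nat.find_min hex hk
    push Not at this; exact this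
  have e := PP_congr σ (j :: w0) (j' :: w0') ε n h2
  have key : ∀ ε : ℕ → Bool, dd σ (j :: w0) (j' :: w0') ε (PP σ (j :: w0) (j' :: w0') ε n ++ σ n).length = if ε n then j else j' := by
    intro ε
    have hp : PP σ (j :: w0) (j' :: w0') ε (n+1) = (PP σ (j :: w0) (j' :: w0') ε n ++ σ n) ++ (if ε n then (j :: w0) else (j' :: w0')) := by
      rw [PP, List.append_assoc]
    rw [dd_eq (n := n+1) _ _ _ _ (by simp) (by simp), hp]
    · rw [List.getD_append_right _ _ _ _ le_rfl]
      split <;> simp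
    · rw [hp, List.length_append]
      split <;> simp
  have k1 := key ε
  have k2 := key ε'
  rw [h, e, k2] at k1
  cases h3 : ε n <;> cases h4 : ε' n <;> simp_all
end

namespace Dat
noncomputable section
variable (D : Dat)

lemma coding_exists {E : Set ℝ} (hE : E ⊆ Icc D.a D.b) (hne : E.Nonempty) (hcl : IsClosed E)
    (hinv : ∀ i, 1 ≤ i → i ≤ D.m → ∀ x ∈ E, D.f i x ∈ E) (d : ℕ → ℕ) (hd : ∀ n, 1 ≤ d n ∧ d n ≤ D.m) :
    ∃ x ∈ E, ∀ e, Tendsto (fun n => ((List.range n).map d).foldr D.f e) atTop (nhds x) := by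
  have hval : ∀ n, D.Valid ((List.range n).map d) := by
    intro n i hi
    obtain ⟨k, _, rfl⟩ := List.mem_map.1 hi
    exact hd k
  have hEL : ∀ L, D.Valid L → ∀ x ∈ E, L.foldr D.f x ∈ E := by
    intro L
    induction L with
    | nil => intro _ x hx; exact hx
    | cons i L ih =>
      intro h x hx
      rw [valid_cons] at h
      exact hinv i h.1.1 h.1.2 _ (ih h.2 x hx)
  obtain ⟨e0, he0⟩ := hne
  have hc : CauchySeq (fun n => ((List.range n).map d).foldr D.f e0) := by
    refine cauchySeq_of_le_geometric D.q (D.b - D.a) D.hq (fun n => ?_)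
    rw [List.range_succ, List.map_append, List.foldr_append, D.foldr_f _ e0, D.foldr_f _ (List.foldr _ _ _), Real.dist_eq]
    have h := D.rL_pos (hval n)
    have h1 := h.2.2.1
    simp only [List.length_map, List.length_range, List.map_cons, List.map_nil, List.foldr_cons, List.foldr_nil] at h1 ⊢
    have h2 := hE he0
    have h3 := hE (hinv _ (hd n).1 (hd n).2 e0 he0)
    rw [show ∀ A B C E : ℝ, A + B * C - (A + B * E) = B * (C - E) from fun _ _ _ _ => by ring, abs_mul, abs_of_pos h.1, mul_comm]
    have : |e0 - D.f (d n) e0| ≤ D.b - D.a := by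
      rw [abs_le]; constructor <;> linarith [h2.1, h2.2, h3.1, h3.2]
    have h5 := h.1.le
    gcongr
    linarith [D.hab]
  obtain ⟨x, hx⟩ := cauchySeq_tendsto_of_complete hc
  refine ⟨x, hcl.mem_of_tendsto hx (Eventually.of_forall fun n => hEL _ (hval n) _ he0), fun e => ?_⟩
  have h0 : Tendsto (fun n => D.rL ((List.range n).map d)) atTop (nhds 0) := by
    refine squeeze_zero (fun n => (D.rL_pos (hval n)).1.le) (fun n => ?_) (tendsto_pow_atTop_nhds_zero_of_lt_one D.q_pos.le D.hq)
    have := (D.rL_pos (hval n)).2.2.1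
    simpa using this
  have h1 := hx.add (h0.mul_const (e - e0))
  rw [zero_mul, add_zero] at h1
  refine h1.congr fun n => ?_
  rw [D.foldr_f _ e0, D.foldr_f _ e]; ring

lemma construct {E : Set ℝ} (hE : E ⊆ Icc D.a D.b) (hne : E.Nonempty) (hcl : IsClosed E)
    (hinv : ∀ i, 1 ≤ i → i ≤ D.m → ∀ x ∈ E, D.f i x ∈ E) (j j' : ℕ) (w0 w0' : List ℕ) (hj : j ≠ j')
    (hw : D.Valid (j :: w0)) (hw' : D.Valid (j' :: w0')) (heq : ∀ x, (j :: w0).foldr D.f x = (j' :: w0').foldr D.f x)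
    {y : ℝ} (hy : y ∈ D.Good (j :: w0)) :
    ∃ x ∈ E, D.F x = y ∧ ∃ Φ : (ℕ → Bool) → (ℕ → ℕ), Function.Injective Φ ∧ ∀ ε, (∀ n, 1 ≤ Φ ε n ∧ Φ ε n ≤ D.m) ∧
      Tendsto (fun n => ((List.range n).map (Φ ε)).foldr D.f 0) atTop (nhds x) := by
  have hstep : ∀ y : D.Good (j :: w0), ∃ p : List ℕ × D.Good (j :: w0), D.Valid p.1 ∧ (y:ℝ) = (p.1 ++ (j :: w0)).foldr D.g p.2 := by
    rintro ⟨y, hy⟩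
    obtain ⟨L, h1, z, hz, e⟩ := D.Good_step hw hy
    exact ⟨(L, ⟨z, hz⟩), h1, e⟩
  choose nx hnx1 hnx2 using hstep
  obtain ⟨z, hz0, hzs⟩ : ∃ z : ℕ → D.Good (j :: w0), z 0 = ⟨y, hy⟩ ∧ ∀ n, z (n+1) = (nx (z n)).2 :=
    ⟨fun n => (fun p => (nx p).2)^[n] ⟨y, hy⟩, rfl, fun n => Function.iterate_succ_apply' _ _ _⟩
  obtain ⟨σ, hσd⟩ : ∃ σ : ℕ → List ℕ, ∀ n, σ n = (nx (z n)).1 := ⟨fun n => (nx (z n)).1, fun _ => rfl⟩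
  have hz : ∀ n, ((z n : D.Good (j :: w0)) : ℝ) = (σ n ++ (j :: w0)).foldr D.g ((z (n+1) : D.Good (j :: w0)) : ℝ) :=
    fun n => by rw [hzs, hσd]; exact hnx2 (z n)
  have hσ : ∀ n, D.Valid (σ n) := fun n => by rw [hσd]; exact hnx1 (z n)
  have hPv : ∀ ε n, D.Valid (PP σ (j :: w0) (j' :: w0') ε n) := by
    intro ε n
    induction n with
    | zero => simp [PP, Valid]
    | succ n ih =>
      rw [PP, valid_append, valid_append]
      refine ⟨ih, hσ n, ?_⟩
      split
      · exact hw
      · exact hw'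
  have hPe : ∀ ε n x, (PP σ (j :: w0) (j' :: w0') ε n).foldr D.f x = (PP σ (j :: w0) (j' :: w0') (fun _ => true) n).foldr D.f x := by
    intro ε n
    induction n with
    | zero => intro x; rfl
    | succ n ih =>
      intro x
      rw [PP, PP, List.foldr_append, List.foldr_append, List.foldr_append, List.foldr_append, ih]
      congr 2
      simp only [if_true]
      split
      · rfl
      · exact (heq x).symm
  have hPy : ∀ n, y = (PP σ (j :: w0) (j' :: w0') (fun _ => true) n).foldr D.g ((z n : D.Good (j :: w0)) : ℝ) := by
    intro n
    induction n with
    | zero => simp [PP, hz0]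
    | succ n ih =>
      rw [PP, List.foldr_append]
      simp only [if_true]
      rw [← hz n]; exact ih
  have hdv : ∀ ε n, 1 ≤ dd σ (j :: w0) (j' :: w0') ε n ∧ dd σ (j :: w0) (j' :: w0') ε n ≤ D.m := by
    intro ε n
    have hlen := PP_len σ (j :: w0) (j' :: w0') ε (by simp) (by simp) (n+1)
    unfold dd
    rw [List.getD_eq_getElem _ _ hlen]
    exact hPv ε (n+1) _ (List.getElem_mem _)
  have hsubseq : ∀ ε, Tendsto (fun n => (PP σ (j :: w0) (j' :: w0') ε n).length) atTop atTop := fun ε =>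
    tendsto_atTop_mono (fun n => PP_len σ (j :: w0) (j' :: w0') ε (by simp) (by simp) n) tendsto_id
  have hco := fun ε => D.coding_exists hE hne hcl hinv (dd σ (j :: w0) (j' :: w0') ε) (hdv ε)
  choose X hX1 hX2 using hco
  have hX3 : ∀ ε, Tendsto (fun n => (PP σ (j :: w0) (j' :: w0') (fun _ => true) n).foldr D.f D.a) atTop (nhds (X ε)) := by
    intro ε
    have := (hX2 ε D.a).comp (hsubseq ε)
    refine this.congr fun n => ?_
    simp only [Function.comp]
    rw [dd_range _ _ _ _ (by simp) (by simp), hPe]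
  have hXe : ∀ ε, X ε = X (fun _ => true) := fun ε => tendsto_nhds_unique (hX3 ε) (hX3 _)
  refine ⟨X (fun _ => true), hX1 _, ?_, dd σ (j :: w0) (j' :: w0'), dd_inj σ j j' w0 w0' hj, fun ε => ⟨hdv ε, ?_⟩⟩
  · obtain ⟨C, hC⟩ := D.holder
    have hcont := hC.continuousOn (Real.toNNReal_pos.2 D.hs)
    have h1 := hcont (X (fun _ => true)) (hE (hX1 _))
    have hmem : ∀ n, (PP σ (j :: w0) (j' :: w0') (fun _ => true) n).foldr D.f D.a ∈ Icc D.a D.b := fun n =>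
      D.foldr_f_mem (hPv _ n) ⟨le_rfl, D.hab.le⟩
    have h2 : Tendsto (fun n => D.F ((PP σ (j :: w0) (j' :: w0') (fun _ => true) n).foldr D.f D.a)) atTop (nhds (D.F (X (fun _ => true)))) :=
      h1.tendsto.comp (tendsto_nhdsWithin_iff.2 ⟨hX3 _, Eventually.of_forall hmem⟩)
    have h3 : Tendsto (fun n => D.F ((PP σ (j :: w0) (j' :: w0') (fun _ => true) n).foldr D.f D.a)) atTop (nhds y) := by
      rw [tendsto_iff_dist_tendsto_zero]
      refine squeeze_zero (fun n => dist_nonneg) (fun n => ?_) (tendsto_pow_atTop_nhds_zero_of_lt_one D.q_pos.le D.hq)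
      rw [D.F_foldr (hPv _ n) ⟨le_rfl, D.hab.le⟩, D.F_a]
      conv_lhs => rw [hPy n]
      rw [D.foldr_g _ (z n : ℝ), Real.dist_eq]
      have hp := D.rL_pos (hPv (fun _ => true) n)
      have hz1 := (z n).2.1
      rw [show ∀ A B : ℝ, A - (A + B) = -B from fun _ _ => by ring, abs_neg, abs_of_nonneg (mul_nonneg hp.2.1.le hz1.1)]
      have hl := PP_len σ (j :: w0) (j' :: w0') (fun _ => true) (by simp) (by simp) n
      calc _ ≤ D.pL (PP σ (j :: w0) (j' :: w0') (fun _ => true) n) * 1 := by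
            have := hp.2.1.le
            gcongr; exact hz1.2
        _ ≤ D.q ^ (PP σ (j :: w0) (j' :: w0') (fun _ => true) n).length := by rw [mul_one]; exact hp.2.2.2.1
        _ ≤ D.q ^ n := pow_le_pow_of_le_one D.q_pos.le D.hq.le hl
    exact tendsto_nhds_unique h2 h3
  · rw [← hXe ε]; exact hX2 ε 0

end
end Dat
lemma iter_aff (r t : ℝ) (n : ℕ) (z : ℝ) : (fun x => r * x + t)^[n] z = (fun x => r * x + t)^[n] 0 + r ^ n * z := by
  induction n with
  | zero => simp
  | succ n ih => rw [Function.iterate_succ_apply', Function.iterate_succ_apply', ih]; ring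

lemma exists_qq (m : ℕ) (r : ℕ → ℝ) (hr : ∀ i, 1 ≤ i → i ≤ m → r i < 1) : ∃ q < 1, 0 < q ∧ ∀ i, 1 ≤ i → i ≤ m → r i ≤ q := by
  induction m with
  | zero => exact ⟨1/2, by norm_num, by norm_num, fun i h1 h2 => by omega⟩
  | succ m ih =>
    obtain ⟨q, h1, h0, h2⟩ := ih (fun i a b => hr i a (by omega))
    refine ⟨max q (r (m+1)), max_lt h1 (hr _ (by omega) le_rfl), lt_max_of_lt_left h0, fun i a b => ?_⟩
    rcases Nat.lt_or_ge i (m+1) with h | h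
    · exact (h2 i a (by omega)).trans (le_max_left _ _)
    · obtain rfl : i = m+1 := by omega
      exact le_max_right _ _

open Classical in
lemma exists_ss (m : ℕ) (r : ℕ → ℝ) (hr : ∀ i, 1 ≤ i → i ≤ m → 0 < r i ∧ r i < 1) (ov : ℕ → Prop) (u : ℕ → ℕ)
    (i0 : ℕ) (h1 : 1 ≤ i0) (h2 : i0 < m) (h3 : ¬ ov i0) :
    ∃ s : ℝ, 0 < s ∧ (∑ k ∈ Finset.Ico 1 m, (r k ^ s - if ov k then r k ^ s * (r m ^ s) ^ u k else 0)) + r m ^ s = 1 := by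
  obtain ⟨q, hq1, hq0, hq⟩ := exists_qq m r (fun i a b => (hr i a b).2)
  set G : ℝ → ℝ := fun s => (∑ k ∈ Finset.Ico 1 m, (r k ^ s - if ov k then r k ^ s * (r m ^ s) ^ u k else 0)) + r m ^ s with hG
  have hrc : ∀ i, 1 ≤ i → i ≤ m → Continuous (fun s : ℝ => r i ^ s) := fun i a b =>
    Real.continuous_const_rpow (hr i a b).1.ne'
  have hc : Continuous G := by
    refine Continuous.add (continuous_finset_sum _ fun k hk => ?_) (hrc m (by omega) le_rfl)
    rw [Finset.mem_Ico] at hk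
    have e1 := hrc k hk.1 hk.2.le
    have e2 := hrc m (by omega) le_rfl
    split
    · exact e1.sub (e1.mul (e2.pow _))
    · exact e1.sub continuous_const
  have hG0 : 2 ≤ G 0 := by
    simp only [hG, Real.rpow_zero, one_pow, mul_one]
    have : (1:ℝ) - (if ov i0 then 1 else 0) ≤ ∑ k ∈ Finset.Ico 1 m, ((1:ℝ) - if ov k then 1 else 0) := by
      refine Finset.single_le_sum (f := fun k => (1:ℝ) - if ov k then 1 else 0) (fun k _ => ?_) (Finset.mem_Ico.2 ⟨h1, h2⟩)
      split <;> norm_num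
    rw [if_neg h3] at this
    linarith
  have hN : ∃ n : ℕ, (m:ℝ) * q ^ n < 1 := by
    have := (tendsto_pow_atTop_nhds_zero_of_lt_one hq0.le hq1).const_mul (m:ℝ)
    rw [mul_zero] at this
    exact (this.eventually (gt_mem_nhds one_pos)).exists
  obtain ⟨n, hn⟩ := hN
  have hGn : G n ≤ 1 := by
    have hb : ∀ i, 1 ≤ i → i ≤ m → r i ^ (n:ℝ) ≤ q ^ n := fun i a b => by
      rw [Real.rpow_natCast]
      exact pow_le_pow_left₀ (hr i a b).1.le (hq i a b) n
    have : ∑ k ∈ Finset.Ico 1 m, (r k ^ (n:ℝ) - if ov k then r k ^ (n:ℝ) * (r m ^ (n:ℝ)) ^ u k else 0) ≤ ∑ k ∈ Finset.Ico 1 m, q ^ n := by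
      refine Finset.sum_le_sum fun k hk => ?_
      rw [Finset.mem_Ico] at hk
      have e1 := hb k hk.1 hk.2.le
      have e2 := Real.rpow_pos_of_pos (hr k hk.1 hk.2.le).1 (n:ℝ)
      have e3 := Real.rpow_pos_of_pos (hr m (by omega) le_rfl).1 (n:ℝ)
      have : 0 ≤ if ov k then r k ^ (n:ℝ) * (r m ^ (n:ℝ)) ^ u k else 0 := by
        split <;> positivity
      linarith
    rw [Finset.sum_const, Nat.card_Ico, nsmul_eq_mul, Nat.cast_sub (by omega)] at this
    have e4 := hb m (by omega) le_rfl
    simp only [hG]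
    push_cast at this
    linarith
  obtain ⟨s, hs, e⟩ := intermediate_value_Icc' (Nat.cast_nonneg n) hc.continuousOn ⟨hGn, (by linarith : (1:ℝ) ≤ G 0)⟩
  refine ⟨s, lt_of_le_of_ne hs.1 ?_, e⟩
  rintro rfl
  linarith

namespace ClassE
variable (S : ClassE)

lemma E_sub : S.E ⊆ Icc S.a S.b := fun _ hx =>
  ⟨csInf_le S.hEcpt.bddBelow hx, le_csSup S.hEcpt.bddAbove hx⟩

lemma f_inv (i : ℕ) (h1 : 1 ≤ i) (h2 : i ≤ S.m) (x : ℝ) (hx : x ∈ S.E) : S.r i * x + S.t i ∈ S.E := by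
  rw [S.hEinv]
  simp only [mem_iUnion]
  exact ⟨i, Finset.mem_Icc.2 ⟨h1, h2⟩, x, hx, rfl⟩

lemma f_ex (x : ℝ) (hx : x ∈ S.E) : ∃ i, 1 ≤ i ∧ i ≤ S.m ∧ ∃ y ∈ S.E, x = S.r i * y + S.t i := by
  rw [S.hEinv] at hx
  simp only [mem_iUnion] at hx
  obtain ⟨i, hi, y, hy, e⟩ := hx
  rw [Finset.mem_Icc] at hi
  exact ⟨i, hi.1, hi.2, y, hy, e.symm⟩

lemma f_img (i : ℕ) (h1 : 1 ≤ i) (h2 : i ≤ S.m) : S.f i '' S.I = Icc (S.f i S.a) (S.f i S.b) :=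
  image_affine_Icc' (S.hr i h1 h2).1 _ _ _

lemma f_iter_aff (i n : ℕ) (z : ℝ) : (S.f i)^[n] z = (S.f i)^[n] 0 + S.r i ^ n * z := iter_aff _ _ _ _

lemma f_img2 (i k n : ℕ) (h1 : 1 ≤ i) (h2 : i ≤ S.m) (h3 : 1 ≤ k) (h4 : k ≤ S.m) :
    (S.f i ∘ (S.f k)^[n]) '' S.I = Icc (S.f i ((S.f k)^[n] S.a)) (S.f i ((S.f k)^[n] S.b)) := by
  have hp : 0 < S.r i * S.r k ^ n := mul_pos (S.hr i h1 h2).1 (pow_pos (S.hr k h3 h4).1 _)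
  have e : S.f i ∘ (S.f k)^[n] = fun x => (S.r i * S.r k ^ n) * x + (S.r i * (S.f k)^[n] 0 + S.t i) := by
    funext x
    simp only [Function.comp]
    rw [f_iter_aff]; unfold f; ring
  have e2 : ∀ x, S.f i ((S.f k)^[n] x) = (S.r i * S.r k ^ n) * x + (S.r i * (S.f k)^[n] 0 + S.t i) := fun x => congrFun e x
  rw [e, e2, e2]
  exact image_affine_Icc' hp _ _ _

def ovl (i : ℕ) : Prop := S.f i '' S.I ∩ S.f (i + 1) '' S.I ≠ ∅

lemma dD (hab : S.a < S.b) (hA : S.condA) (hD : S.condD) (i : ℕ) (h1 : 1 ≤ i) (h2 : i < S.m) (ho : S.ovl i) :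
    ∃ u v : ℕ, 1 ≤ u ∧ 1 ≤ v ∧ (∀ z, S.f i ((S.f S.m)^[u] z) = S.f (i+1) ((S.f 1)^[v] z)) ∧
      S.r i * S.r S.m ^ u = S.r (i+1) * S.r 1 ^ v := by
  obtain ⟨u, v, hu, hv, e1, e2⟩ := hD i h1 h2 ho
  refine ⟨u, v, hu, hv, ?_⟩
  have hm := S.hm
  have hne := Set.nonempty_iff_ne_empty.2 ho
  rw [e1] at e2 hne
  rw [f_img2 S _ _ _ h1 h2.le (by omega) le_rfl] at e2 hne
  rw [f_img2 S _ _ _ (by omega) h2 le_rfl (by omega)] at e2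
  have hle := Set.nonempty_Icc.1 hne
  have hab2 := (Set.Icc_eq_Icc_iff hle).1 e2
  have k1 : ∀ z, S.f i ((S.f S.m)^[u] z) = (S.r i * S.r S.m ^ u) * z + (S.r i * (S.f S.m)^[u] 0 + S.t i) := fun z => by
    rw [f_iter_aff]; unfold f; ring
  have k2 : ∀ z, S.f (i+1) ((S.f 1)^[v] z) = (S.r (i+1) * S.r 1 ^ v) * z + (S.r (i+1) * (S.f 1)^[v] 0 + S.t (i+1)) := fun z => by
    rw [f_iter_aff]; unfold f; ring
  obtain ⟨ha, hb⟩ := hab2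
  rw [k1, k2] at ha hb
  have hs : S.r i * S.r S.m ^ u = S.r (i+1) * S.r 1 ^ v := by
    have : (S.r i * S.r S.m ^ u - S.r (i+1) * S.r 1 ^ v) * (S.b - S.a) = 0 := by linarith
    rcases mul_eq_zero.1 this with h | h <;> linarith
  refine ⟨fun z => ?_, hs⟩
  rw [k1, k2]
  rw [hs] at ha ⊢
  linarith

lemma prefix_eq (d : ℕ → ℕ) (n : ℕ) (x : ℝ) : S.prefixMap d n x = ((List.range n).map d).foldr S.f x := by
  induction n generalizing x with
  | zero => rfl
  | succ n ih => rw [prefixMap, Function.comp, ih, List.range_succ, List.map_append, List.foldr_append]; rfl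

lemma disj {p q p' q' : ℝ} (h : p ≤ q) (h' : p' ≤ q') (hp : p ≤ p') (hd : Icc p q ∩ Icc p' q' = ∅) : q < p' := by
  by_contra hc
  have : p' ∈ Icc p q ∩ Icc p' q' := ⟨⟨hp, by linarith⟩, le_rfl, h'⟩
  rw [hd] at this; exact this

open Classical in
lemma mkDat (hS : S.goodE) : ∃ D : Dat, D.m = S.m ∧ D.r = S.r ∧ D.t = S.t ∧ D.a = S.a ∧ D.b = S.b ∧ D.ov = S.ovl := by
  obtain ⟨hA, hB, ⟨⟨i0, hi1, hi2, hi3⟩, _⟩, hD⟩ := hS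
  have hm := S.hm
  have hab : S.a < S.b := by
    have h1 := hA.2.2.1
    have h2 := (S.hr S.m (by omega) le_rfl).1
    unfold f at h1
    have : S.r S.m * S.a < S.r S.m * S.b := by linarith
    exact lt_of_mul_lt_mul_left this h2.le
  have hfab : ∀ i, 1 ≤ i → i ≤ S.m → S.f i S.a ≤ S.f i S.b := fun i a b => by
    have := (S.hr i a b).1
    unfold f; gcongr
  have hdd := S.dD hab hA hD
  have hdd2 : ∀ i, ∃ u v : ℕ, 1 ≤ i → i < S.m → S.ovl i → 1 ≤ u ∧ 1 ≤ v ∧ (∀ z, S.f i ((S.f S.m)^[u] z) = S.f (i+1) ((S.f 1)^[v] z)) ∧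
      S.r i * S.r S.m ^ u = S.r (i+1) * S.r 1 ^ v := by
    intro i
    by_cases h : 1 ≤ i ∧ i < S.m ∧ S.ovl i
    · obtain ⟨u, v, h'⟩ := hdd i h.1 h.2.1 h.2.2
      exact ⟨u, v, fun _ _ _ => h'⟩
    · exact ⟨0, 0, fun a b c => absurd ⟨a, b, c⟩ h⟩
  choose u v huv using hdd2
  obtain ⟨s, hs, hse⟩ := exists_ss S.m S.r S.hr S.ovl u i0 hi1 hi2 (not_not.2 hi3)
  obtain ⟨q1, hq1, hq10, hq1'⟩ := exists_qq S.m S.r (fun i a b => (S.hr i a b).2)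
  obtain ⟨q2, hq2, hq20, hq2'⟩ := exists_qq S.m (fun i => S.r i ^ s) (fun i a b => Real.rpow_lt_one (S.hr i a b).1.le (S.hr i a b).2 hs)
  let c : ℕ → ℝ := fun i => ∑ k ∈ Finset.Ico 1 i, (S.r k ^ s - if S.ovl k then S.r k ^ s * (S.r S.m ^ s) ^ u k else 0)
  have hcs : ∀ i, 1 ≤ i → c (i+1) = c i + (S.r i ^ s - if S.ovl i then S.r i ^ s * (S.r S.m ^ s) ^ u i else 0) := fun i hi =>
    Finset.sum_Ico_succ_top hi _
  refine ⟨{ m := S.m, hm := hm, r := S.r, t := S.t, a := S.a, b := S.b, hab := hab, ov := S.ovl, u := u, v := v, s := s, hs := hs,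
            c := c, q := max q1 q2, hq := max_lt hq1 hq2, hr := fun i a b => (S.hr i a b).1,
            hrq := fun i a b => (hq1' i a b).trans (le_max_left _ _),
            hpq := fun i a b => (hq2' i a b).trans (le_max_right _ _),
            fa := hA.1, fb := hA.2.2.2, lt := hA.2.1, hB := ?_, hu := fun i a b h => (huv i a b h).1,
            hv := fun i a b h => (huv i a b h).2.1, hD := fun i a b h => (huv i a b h).2.2.1,
            hDr := fun i a b h => (huv i a b h).2.2.2, hgap := ?_, c1 := by simp [c], cov := ?_, cgap := ?_, cm := hse }, rfl, rfl, rfl, rfl, rfl, rfl⟩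
  · intro i h1 h2
    have := hB i h1 h2
    rw [S.f_img i h1 (by omega), S.f_img (i+2) (by omega) h2] at this
    exact disj (hfab i h1 (by omega)) (hfab (i+2) (by omega) h2) ((hA.2.1 i h1 (by omega)).trans (hA.2.1 (i+1) (by omega) (by omega))).le this
  · intro i h1 h2 ho
    have := not_not.1 ho
    rw [S.f_img i h1 (by omega), S.f_img (i+1) (by omega) h2] at this
    exact disj (hfab i h1 (by omega)) (hfab (i+1) (by omega) h2) (hA.2.1 i h1 (by omega)).le this
  · intro i h1 h2 ho
    rw [hcs i h1, if_pos ho]; ring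
  · intro i h1 h2 ho
    rw [hcs i h1, if_neg ho]; ring

lemma foldr_rep {α β : Type*} (f : α → β → β) (k : α) (n : ℕ) (z : β) : (List.replicate n k).foldr f z = (f k)^[n] z := by
  induction n with
  | zero => rfl
  | succ n ih => rw [List.replicate_succ, List.foldr_cons, ih, Function.iterate_succ_apply']

lemma main (hS : S.goodE) : ∃ s : ℝ, 0 < s ∧ μH[s] (S.U Cardinal.continuum) ≠ 0 ∧ μH[s] S.E < ⊤ := by
  obtain ⟨D, em, er, et, ea, eb, eo⟩ := S.mkDat hS
  obtain ⟨-, -, ⟨-, ⟨j, hj1, hj2, hj3⟩⟩, -⟩ := hS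
  have ef : D.f = S.f := by
    funext i x; unfold Dat.f f; rw [er, et]
  have hE : S.E ⊆ Icc D.a D.b := by rw [ea, eb]; exact S.E_sub
  have hinv : ∀ i, 1 ≤ i → i ≤ D.m → ∀ x ∈ S.E, D.f i x ∈ S.E := by
    rw [em, ef]; exact S.f_inv
  have hm := D.hm
  refine ⟨D.s, D.hs, ?_, D.upper S.E hE (by rw [em, ef]; exact S.f_ex)⟩
  have hov : D.ov j := by rw [eo]; exact hj3
  have hjm : j < D.m := by omega
  have hw : D.Valid (j :: List.replicate (D.u j) D.m) := by
    intro i hi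
    rcases List.mem_cons.1 hi with rfl | hi
    · exact ⟨hj1, hjm.le⟩
    · rw [List.eq_of_mem_replicate hi]; exact ⟨by omega, le_rfl⟩
  have hw' : D.Valid ((j+1) :: List.replicate (D.v j) 1) := by
    intro i hi
    rcases List.mem_cons.1 hi with rfl | hi
    · exact ⟨by omega, hjm⟩
    · rw [List.eq_of_mem_replicate hi]; exact ⟨by omega, by omega⟩
  have heq : ∀ x, (j :: List.replicate (D.u j) D.m).foldr D.f x = ((j+1) :: List.replicate (D.v j) 1).foldr D.f x := by
    intro x
    rw [List.foldr_cons, List.foldr_cons, foldr_rep, foldr_rep]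
    exact D.hD j hj1 hjm hov x
  have hsub : D.Good (j :: List.replicate (D.u j) D.m) ⊆ D.F '' S.U Cardinal.continuum := by
    intro y hy
    obtain ⟨x, hx, hFx, Φ, hΦ, hc⟩ := D.construct hE S.hEne S.hEcpt.isClosed hinv j (j+1) _ _ (by omega) hw hw' heq hy
    refine ⟨x, ⟨hx, le_antisymm ?_ ?_⟩, hFx⟩
    · refine (Cardinal.mk_set_le _).trans ?_
      simp
    · have hmem : ∀ ε, Φ ε ∈ S.codings x := fun ε => by
        refine ⟨by rw [← em]; exact (hc ε).1, ?_⟩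
        have := (hc ε).2
        rw [ef] at this
        exact this.congr fun n => (S.prefix_eq _ _ _).symm
      have := Cardinal.mk_le_of_injective (f := fun ε => (⟨Φ ε, hmem ε⟩ : S.codings x)) (fun ε ε' h => hΦ (congrArg Subtype.val h))
      simpa using this
  have hvol : volume (D.F '' S.U Cardinal.continuum) ≠ 0 := fun h => D.Good_vol hw (measure_mono_null hsub h)
  obtain ⟨C, hC⟩ := D.holder
  have hU : S.U Cardinal.continuum ⊆ Icc D.a D.b := fun x hx => hE hx.1
  have h := (hC.mono hU).hausdorffMeasure_image_le (Real.toNNReal_pos.2 D.hs) (d := 1) zero_le_one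
  rw [hausdorffMeasure_real, mul_one, Real.coe_toNNReal _ D.hs.le] at h
  intro h0
  rw [h0, mul_zero] at h
  exact hvol (le_antisymm h bot_le)

end ClassE

theorem stmt2 (S : ClassE) (hS : S.goodE) :
    dimH (S.U Cardinal.continuum) = dimH S.E ∧
      0 < μH[(dimH S.E).toReal] (S.U Cardinal.continuum) ∧
      μH[(dimH S.E).toReal] (S.U Cardinal.continuum) < ⊤ := by
  obtain ⟨s, hs, h1, h2⟩ := S.main hS
  have hsub : S.U Cardinal.continuum ⊆ S.E := fun x hx => hx.1
  have h3 : μH[s] (S.U Cardinal.continuum) < ⊤ := (measure_mono hsub).trans_lt h2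
  have h4 : μH[s] S.E ≠ 0 := fun h => h1 (measure_mono_null hsub h)
  have es : ((s.toNNReal : NNReal) : ℝ) = s := Real.coe_toNNReal _ hs.le
  have d1 : dimH (S.U Cardinal.continuum) = s.toNNReal :=
    dimH_of_hausdorffMeasure_ne_zero_ne_top (by rw [es]; exact h1) (by rw [es]; exact h3.ne)
  have d2 : dimH S.E = s.toNNReal :=
    dimH_of_hausdorffMeasure_ne_zero_ne_top (by rw [es]; exact h4) (by rw [es]; exact h2.ne)
  rw [d1, d2]
  refine ⟨rfl, ?_⟩
  rw [ENNReal.coe_toReal, es]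
  exact ⟨pos_iff_ne_zero.2 h1, h3⟩
end

section
/- For any (E, {f_i}_{i=1}^m) ∈ 𝓔 the following dichotomy holds: either dim_H U_k(E) = dim_H U_1(E) for all integers k ≥ 1, or dim_H U_k(E) = dim_H U_1(E) whenever k = 2^s for some integer s ≥ 0 and U_k(E) = ∅ for every integer k ≥ 1 that is not a power of 2. -/
open Set Filter MeasureTheory

namespace ClassE

/-- valid digit -/
def vd (S : ClassE) (i : ℕ) : Prop := 1 ≤ i ∧ i ≤ S.m

/-- prepend a digit -/
def cns (i : ℕ) (d : ℕ → ℕ) : ℕ → ℕ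
  | 0 => i
  | n + 1 => d n

/-- number of codings -/
noncomputable def N (S : ClassE) (x : ℝ) : ℕ∞ := (S.codings x).encard

/-- increasing affine map -/
def Aff (g : ℝ → ℝ) : Prop := ∃ k t : ℝ, 0 < k ∧ ∀ x, g x = k * x + t

/-- map of a word -/
def fw (S : ClassE) : List ℕ → ℝ → ℝ
  | [] => id
  | i :: w => S.f i ∘ S.fw w

theorem cns_eta (d : ℕ → ℕ) : cns (d 0) (fun n => d (n + 1)) = d := by
  funext n; cases n <;> rfl

theorem cns_inj (i : ℕ) : Function.Injective (cns i) := by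
  intro d e h
  funext n
  exact congrFun h (n + 1)

theorem Aff.comp {g h : ℝ → ℝ} (hg : Aff g) (hh : Aff h) : Aff (g ∘ h) := by
  obtain ⟨k, t, hk, hg⟩ := hg
  obtain ⟨l, s, hl, hh⟩ := hh
  exact ⟨k * l, k * s + t, by positivity, fun x => by simp [hg, hh]; ring⟩

theorem Aff.iter {g : ℝ → ℝ} (hg : Aff g) (n : ℕ) : Aff (g^[n]) := by
  induction n with
  | zero => exact ⟨1, 0, one_pos, fun x => by simp⟩
  | succ n ih => rw [Function.iterate_succ']; exact hg.comp ih

theorem Aff.mono {g : ℝ → ℝ} (hg : Aff g) : StrictMono g := by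
  obtain ⟨k, t, hk, hg⟩ := hg
  intro x y h
  rw [hg, hg]
  have := mul_lt_mul_of_pos_left h hk
  linarith

theorem Aff.eq_of_image {g h : ℝ → ℝ} (hg : Aff g) (hh : Aff h) {a b : ℝ} (hab : a < b)
    (e : g '' Icc a b = h '' Icc a b) : ∀ x, g x = h x := by
  have key : ∀ {g h : ℝ → ℝ}, Aff g → Aff h → g '' Icc a b = h '' Icc a b → 
      g a ≤ h a ∧ h b ≤ g b := by
    intro g h hg hh e
    constructor
    · have : h a ∈ g '' Icc a b := by rw [e]; exact ⟨a, ⟨le_rfl, hab.le⟩, rfl⟩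
      obtain ⟨y, hy, hy'⟩ := this
      rw [← hy']; exact hg.mono.monotone hy.1
    · have : h b ∈ g '' Icc a b := by rw [e]; exact ⟨b, ⟨hab.le, le_rfl⟩, rfl⟩
      obtain ⟨y, hy, hy'⟩ := this
      rw [← hy']; exact hg.mono.monotone hy.2
  have h1 := key hg hh e
  have h2 := key hh hg e.symm
  have ea : g a = h a := le_antisymm h1.1 h2.1
  have eb : g b = h b := le_antisymm h2.2 h1.2
  obtain ⟨k, t, hk, hg⟩ := hg
  obtain ⟨l, s, hl, hh⟩ := hh
  rw [hg, hh] at ea eb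
  have : (k - l) * (b - a) = 0 := by linarith
  have hkl : k = l := by
    rcases mul_eq_zero.1 this with h | h <;> linarith
  subst hkl
  intro x
  rw [hg, hh]; linarith

theorem dimH_affine_le (k t : ℝ) (V : Set ℝ) : dimH ((fun x => k * x + t) '' V) ≤ dimH V := by
  have : LipschitzWith (Real.toNNReal |k|) (fun x : ℝ => k * x + t) := by
    apply LipschitzWith.of_dist_le_mul
    intro x y
    rw [Real.dist_eq, Real.dist_eq, Real.coe_toNNReal _ (abs_nonneg k), ← abs_mul]
    apply le_of_eq; congr 1; ring
  exact this.dimH_image_le V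

theorem dimH_le_of_aff {g : ℝ → ℝ} (hg : Aff g) {V W : Set ℝ} (h : ∀ x ∈ V, g x ∈ W) :
    dimH V ≤ dimH W := by
  obtain ⟨k, t, hk, hg⟩ := hg
  refine le_trans (dimH_mono ?_) (dimH_affine_le k⁻¹ (- k⁻¹ * t) W)
  intro x hx
  refine ⟨g x, h x hx, ?_⟩
  simp only [hg]; field_simp; ring

theorem dimH_fw_le (S : ClassE) (w : List ℕ) (V : Set ℝ) : dimH (S.fw w '' V) ≤ dimH V := by
  induction w with
  | nil => simp [fw]
  | cons i w ih =>
    rw [fw, image_comp]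
    exact (dimH_affine_le (S.r i) (S.t i) _).trans ih

variable {S : ClassE}

theorem aff_f {i : ℕ} (hi : S.vd i) : Aff (S.f i) :=
  ⟨S.r i, S.t i, (S.hr i hi.1 hi.2).1, fun _ => rfl⟩

theorem f_inj {i : ℕ} (hi : S.vd i) : Function.Injective (S.f i) := (aff_f hi).mono.injective

theorem f_cont (i : ℕ) : Continuous (S.f i) := by
  unfold f; fun_prop

theorem exists_inv {i : ℕ} (hi : S.vd i) (x : ℝ) : ∃ y, x = S.f i y := by
  have := (S.hr i hi.1 hi.2).1
  exact ⟨(x - S.t i) / S.r i, by unfold f; field_simp; ring⟩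

theorem f_dist {i : ℕ} (hi : S.vd i) (x y : ℝ) : |S.f i x - S.f i y| = S.r i * |x - y| := by
  unfold f
  have : S.r i * x + S.t i - (S.r i * y + S.t i) = S.r i * (x - y) := by ring
  rw [this, abs_mul, abs_of_pos (S.hr i hi.1 hi.2).1]

theorem exists_rho (S : ClassE) : ∃ ρ : ℝ, 0 ≤ ρ ∧ ρ < 1 ∧ ∀ i, S.vd i → S.r i ≤ ρ := by
  have hm := S.hm
  obtain ⟨j, hj, hmax⟩ := Finset.exists_max_image (Finset.Icc 1 S.m) S.r ⟨1, by simp; omega⟩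
  rw [Finset.mem_Icc] at hj
  exact ⟨S.r j, (S.hr j hj.1 hj.2).1.le, (S.hr j hj.1 hj.2).2, fun i hi =>
    hmax i (by rw [Finset.mem_Icc]; exact hi)⟩

theorem f_mem_E {i : ℕ} (hi : S.vd i) {x : ℝ} (hx : x ∈ S.E) : S.f i x ∈ S.E := by
  rw [S.hEinv]
  simp only [mem_iUnion]
  exact ⟨i, Finset.mem_Icc.2 hi, x, hx, rfl⟩

theorem E_cases {x : ℝ} (hx : x ∈ S.E) : ∃ i y, S.vd i ∧ y ∈ S.E ∧ x = S.f i y := by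
  rw [S.hEinv] at hx
  simp only [mem_iUnion] at hx
  obtain ⟨i, hi, y, hy, h⟩ := hx
  exact ⟨i, y, Finset.mem_Icc.1 hi, hy, h.symm⟩

theorem E_sub_I {x : ℝ} (hx : x ∈ S.E) : x ∈ S.I :=
  ⟨csInf_le S.hEcpt.bddBelow hx, le_csSup S.hEcpt.bddAbove hx⟩

theorem a_mem : S.a ∈ S.E := S.hEcpt.sInf_mem S.hEne
theorem b_mem : S.b ∈ S.E := S.hEcpt.sSup_mem S.hEne

theorem f_mem_I {i : ℕ} (hi : S.vd i) {x : ℝ} (hx : x ∈ S.I) : S.f i x ∈ S.I :=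
  ⟨(E_sub_I (f_mem_E hi a_mem)).1.trans ((aff_f hi).mono.monotone hx.1),
   ((aff_f hi).mono.monotone hx.2).trans (E_sub_I (f_mem_E hi b_mem)).2⟩

theorem iter_mem_I {i : ℕ} (hi : S.vd i) {x : ℝ} (hx : x ∈ S.I) (n : ℕ) :
    (S.f i)^[n] x ∈ S.I := by
  induction n with
  | zero => exact hx
  | succ n ih => rw [Function.iterate_succ_apply']; exact f_mem_I hi ih

theorem iter_mem_E {i : ℕ} (hi : S.vd i) {x : ℝ} (hx : x ∈ S.E) (n : ℕ) :
    (S.f i)^[n] x ∈ S.E := by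
  induction n with
  | zero => exact hx
  | succ n ih => rw [Function.iterate_succ_apply']; exact f_mem_E hi ih

theorem iter_image {i : ℕ} (hi : S.vd i) {n : ℕ} (hn : 1 ≤ n) {x : ℝ}
    (hx : x ∈ (S.f i)^[n] '' S.I) : x ∈ S.f i '' S.I := by
  obtain ⟨y, hy, rfl⟩ := hx
  obtain ⟨k, rfl⟩ : ∃ k, n = k + 1 := ⟨n - 1, by omega⟩
  rw [Function.iterate_succ_apply']
  exact ⟨_, iter_mem_I hi hy k, rfl⟩

theorem prefix_cns (i : ℕ) (d : ℕ → ℕ) (n : ℕ) (x : ℝ) :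
    S.prefixMap (cns i d) (n + 1) x = S.f i (S.prefixMap d n x) := by
  induction n generalizing x with
  | zero => rfl
  | succ n ih =>
    rw [prefixMap, Function.comp_apply, ih]; rfl

theorem prefix_dist {d : ℕ → ℕ} (hd : ∀ n, S.vd (d n)) {ρ : ℝ} (h0 : 0 ≤ ρ)
    (hρ : ∀ i, S.vd i → S.r i ≤ ρ) (n : ℕ) (x y : ℝ) :
    |S.prefixMap d n x - S.prefixMap d n y| ≤ ρ ^ n * |x - y| := by
  induction n generalizing x y with
  | zero => simp [prefixMap]
  | succ n ih =>
    rw [prefixMap, Function.comp_apply, Function.comp_apply]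
    refine (ih _ _).trans ?_
    rw [f_dist (hd n), pow_succ, mul_assoc]
    have := hρ _ (hd n)
    gcongr

theorem prefix_mem {d : ℕ → ℕ} (hd : ∀ n, S.vd (d n)) (n : ℕ) {x : ℝ} (hx : x ∈ S.E) :
    S.prefixMap d n x ∈ S.E := by
  induction n generalizing x with
  | zero => exact hx
  | succ n ih => exact ih (f_mem_E (hd n) hx)

theorem prefix_tendsto {d : ℕ → ℕ} (hd : ∀ n, S.vd (d n)) (e : ℕ → ℝ) (he : ∀ n, e n ∈ S.E) :
    Tendsto (fun n => S.prefixMap d n 0 - S.prefixMap d n (e n)) atTop (nhds 0) := by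
  obtain ⟨ρ, h0, h1, hρ⟩ := S.exists_rho
  obtain ⟨C, hC⟩ := S.hEcpt.isBounded.exists_norm_le
  refine squeeze_zero_norm (a := fun n => ρ ^ n * C) (fun n => ?_) ?_
  · rw [Real.norm_eq_abs]
    refine (prefix_dist hd h0 hρ n _ _).trans ?_
    have := hC _ (he n)
    rw [Real.norm_eq_abs] at this
    rw [zero_sub, abs_neg]
    gcongr
  · have := (tendsto_pow_atTop_nhds_zero_of_lt_one h0 h1).mul_const C
    simpa using this

theorem coding_mem {d : ℕ → ℕ} {x : ℝ} (h : S.isCoding d x) : x ∈ S.E := by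
  obtain ⟨e, he⟩ := S.hEne
  have h1 := prefix_tendsto h.1 (fun _ => e) (fun _ => he)
  have h2 := h.2.sub h1
  simp only [sub_sub_cancel, sub_zero] at h2
  exact S.hEcpt.isClosed.mem_of_tendsto h2 (Eventually.of_forall fun n => prefix_mem h.1 n he)

theorem exists_coding {x : ℝ} (hx : x ∈ S.E) : ∃ d, S.isCoding d x := by
  choose! D Y h1 h2 h3 using fun x (hx : x ∈ S.E) => E_cases hx
  have hY : ∀ n, Y^[n] x ∈ S.E := by
    intro n
    induction n with
    | zero => exact hx
    | succ n ih => rw [Function.iterate_succ_apply']; exact h2 _ ih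
  let d : ℕ → ℕ := fun n => D (Y^[n] x)
  have hd : ∀ n, S.vd (d n) := fun n => h1 _ (hY n)
  have hp : ∀ n, S.prefixMap d n (Y^[n] x) = x := by
    intro n
    induction n with
    | zero => rfl
    | succ n ih =>
      rw [prefixMap, Function.comp_apply, Function.iterate_succ_apply']
      rw [← h3 _ (hY n), ih]
  refine ⟨d, hd, ?_⟩
  have := prefix_tendsto hd _ hY
  simp only [hp] at this
  have h := this.add_const x
  simpa using h

theorem coding_cns {i : ℕ} {d : ℕ → ℕ} {y : ℝ} (hi : S.vd i) :
    S.isCoding (cns i d) (S.f i y) ↔ S.isCoding d y := by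
  unfold isCoding
  constructor
  · rintro ⟨h1, h2⟩
    refine ⟨fun n => h1 (n + 1), ?_⟩
    have h3 := (tendsto_add_atTop_iff_nat 1).2 h2
    simp only [prefix_cns] at h3
    have hr := (S.hr i hi.1 hi.2).1
    have h4 := (h3.sub_const (S.t i)).div_const (S.r i)
    have key : ∀ z, (S.f i z - S.t i) / S.r i = z := fun z => by
      unfold f; field_simp; ring
    simpa only [key] using h4
  · rintro ⟨h1, h2⟩
    refine ⟨fun n => by cases n; exacts [hi, h1 _], ?_⟩
    rw [← tendsto_add_atTop_iff_nat 1]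
    simp only [prefix_cns]
    exact ((f_cont i).tendsto y).comp h2

theorem coding_tail {d : ℕ → ℕ} {x : ℝ} (h : S.isCoding d x) :
    ∃ y, x = S.f (d 0) y ∧ S.isCoding (fun n => d (n + 1)) y := by
  obtain ⟨y, rfl⟩ := exists_inv (h.1 0) x
  refine ⟨y, rfl, (coding_cns (h.1 0)).1 ?_⟩
  rwa [cns_eta]

theorem coding_first {d : ℕ → ℕ} {x : ℝ} (h : S.isCoding d x) : x ∈ S.f (d 0) '' S.I := by
  obtain ⟨y, rfl, hy⟩ := coding_tail h
  exact ⟨y, E_sub_I (coding_mem hy), rfl⟩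

theorem N_pos {x : ℝ} : 1 ≤ S.N x ↔ x ∈ S.E := by
  rw [N, one_le_encard_iff_nonempty]
  exact ⟨fun ⟨d, hd⟩ => coding_mem hd, fun h => exists_coding h⟩

theorem mem_U {k : ℕ} (hk : 1 ≤ k) {x : ℝ} : x ∈ S.U k ↔ S.N x = k := by
  have : Cardinal.mk (S.codings x) = (k : Cardinal) ↔ S.N x = k := by
    rw [N, encard, ENat.card, Cardinal.toENat_eq_natCast]
  unfold U
  rw [mem_ofPred, this]
  refine ⟨fun h => h.2, fun h => ⟨N_pos.1 ?_, h⟩⟩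
  rw [h]; exact_mod_cast hk

theorem mem_U1 {x : ℝ} : x ∈ S.U 1 ↔ S.N x = 1 := by
  have := mem_U (S := S) (k := 1) le_rfl (x := x)
  simpa using this

theorem cns_image_sub {i : ℕ} (hi : S.vd i) (y : ℝ) :
    cns i '' S.codings y ⊆ S.codings (S.f i y) := by
  rintro _ ⟨d, hd, rfl⟩
  exact (coding_cns hi).2 hd

theorem N_cns (i : ℕ) (y : ℝ) : (cns i '' S.codings y).encard = S.N y :=
  (cns_inj i).encard_image _

theorem N_le {i : ℕ} (hi : S.vd i) (y : ℝ) : S.N y ≤ S.N (S.f i y) := by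
  rw [← N_cns i y]
  exact encard_le_encard (cns_image_sub hi y)

theorem N_lt {i : ℕ} (hi : S.vd i) (y : ℝ) {d : ℕ → ℕ} (hd : S.isCoding d (S.f i y))
    (h0 : d 0 ≠ i) : S.N y + 1 ≤ S.N (S.f i y) := by
  have hn : d ∉ cns i '' S.codings y := by
    rintro ⟨e, -, rfl⟩; exact h0 rfl
  rw [← N_cns i y, ← encard_insert_of_notMem hn]
  apply encard_le_encard
  rw [insert_subset_iff]
  exact ⟨hd, cns_image_sub hi y⟩

theorem N_eq' {i : ℕ} (hi : S.vd i) (y : ℝ) (h : ∀ d, S.isCoding d (S.f i y) → d 0 = i) :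
    S.N (S.f i y) = S.N y := by
  rw [← N_cns i y, N]
  congr 1
  refine Subset.antisymm (fun d hd => ?_) (cns_image_sub hi y)
  have h0 := h d hd
  refine ⟨fun n => d (n + 1), ?_, by rw [← h0]; exact cns_eta d⟩
  refine (coding_cns hi).1 ?_
  rw [← h0, cns_eta, h0]; exact hd

theorem N_eq {i : ℕ} (hi : S.vd i) (y : ℝ)
    (h : ∀ j, S.vd j → j ≠ i → S.f i y ∉ S.f j '' S.I) :
    S.N (S.f i y) = S.N y := by
  apply N_eq' hi
  intro d hd
  by_contra hne
  exact h _ (hd.1 0) hne (coding_first hd)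

theorem N_add {i j : ℕ} (hi : S.vd i) (hj : S.vd j) (hij : i ≠ j) {y z : ℝ}
    (e : S.f i y = S.f j z)
    (h : ∀ l, S.vd l → l ≠ i → l ≠ j → S.f i y ∉ S.f l '' S.I) :
    S.N (S.f i y) = S.N y + S.N z := by
  rw [← N_cns i y, ← N_cns j z, ← encard_union_eq, N]
  · congr 1
    refine Subset.antisymm (fun d hd => ?_) (union_subset (cns_image_sub hi y) ?_)
    · by_cases h0 : d 0 = i
      · left
        refine ⟨fun n => d (n + 1), ?_, by rw [← h0]; exact cns_eta d⟩
        refine (coding_cns hi).1 ?_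
        rw [← h0, cns_eta, h0]; exact hd
      · by_cases h1 : d 0 = j
        · right
          refine ⟨fun n => d (n + 1), ?_, by rw [← h1]; exact cns_eta d⟩
          refine (coding_cns hj).1 ?_
          rw [← h1, cns_eta, h1, ← e]; exact hd
        · exact absurd (coding_first hd) (h _ (hd.1 0) h0 h1)
    · rw [e]; exact cns_image_sub hj z
  · rw [Set.disjoint_left]
    rintro _ ⟨d, -, rfl⟩ ⟨d', -, h'⟩
    exact hij (congrFun h' 0).symm

/-- find the first branching point -/
theorem branch {k : ℕ} (hk : 2 ≤ k) {x : ℝ} (hx : S.N x = k) :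
    ∃ w y, x = S.fw w y ∧ S.N y = k ∧
      ∃ d d', S.isCoding d y ∧ S.isCoding d' y ∧ d 0 ≠ d' 0 := by
  have key : ∀ n x d d', S.N x = k → S.isCoding d x → S.isCoding d' x → d n ≠ d' n →
      ∃ w y, x = S.fw w y ∧ S.N y = k ∧
      ∃ d d', S.isCoding d y ∧ S.isCoding d' y ∧ d 0 ≠ d' 0 := by
    intro n
    induction n with
    | zero => exact fun x d d' hx hd hd' h => ⟨[], x, rfl, hx, d, d', hd, hd', h⟩
    | succ n ih =>
      intro x d d' hx hd hd' h
      by_cases hb : ∃ d', S.isCoding d' x ∧ d' 0 ≠ d 0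
      · obtain ⟨e, he, he'⟩ := hb
        exact ⟨[], x, rfl, hx, e, d, he, hd, he'⟩
      · push Not at hb
        obtain ⟨y, rfl, hy⟩ := coding_tail hd
        obtain ⟨y', e, hy'⟩ := coding_tail hd'
        rw [hb _ hd'] at e
        have e := f_inj (hd.1 0) e
        subst e
        have := N_eq' (hd.1 0) y hb
        rw [hx] at this
        obtain ⟨w, z, h1, h2⟩ := ih y _ _ this.symm hy hy' h
        exact ⟨d 0 :: w, z, by rw [h1]; rfl, h2⟩
  have h1 : 1 < (S.codings x).encard := by
    rw [← N, hx]; exact_mod_cast hk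
  obtain ⟨d, d', hd, hd', hne⟩ := one_lt_encard_iff.1 h1
  obtain ⟨n, hn⟩ := Function.ne_iff.1 hne
  exact key n x d d' hx hd hd' hn

theorem fw_append (w w' : List ℕ) (x : ℝ) : S.fw (w ++ w') x = S.fw w (S.fw w' x) := by
  induction w with
  | nil => rfl
  | cons i w ih => simp [fw, ih]

theorem exists_univ {k : ℕ} (hk : 1 ≤ k) {x : ℝ} (hx : S.N x = k) :
    ∃ w y, x = S.fw w y ∧ S.N y = 1 := by
  induction k using Nat.strong_induction_on generalizing x with
  | _ k ih =>
    rcases Nat.lt_or_ge 1 k with h | h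
    · obtain ⟨w, y, rfl, hy, d, d', hd, hd', hne⟩ := branch h hx
      obtain ⟨z, rfl, hz⟩ := coding_tail hd
      have h1 := N_lt (hd.1 0) z hd' hne.symm
      rw [hy] at h1
      have h2 : S.N z ≠ ⊤ := by
        intro h; rw [h] at h1; simp at h1
      obtain ⟨l, hl⟩ := ENat.ne_top_iff_exists.1 h2
      rw [← hl] at h1
      have h1' : l + 1 ≤ k := by exact_mod_cast h1
      have h3 : 1 ≤ S.N z := N_pos.2 (coding_mem hz)
      rw [← hl] at h3
      obtain ⟨w', u, rfl, hu⟩ := ih l (by omega) (by exact_mod_cast h3) hl.symm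
      exact ⟨w ++ d 0 :: w', u, by rw [fw_append]; rfl, hu⟩
    · have : k = 1 := by omega
      subst this
      exact ⟨[], x, rfl, by simpa using hx⟩

theorem dim_upper {k : ℕ} (hk : 1 ≤ k) : dimH (S.U k) ≤ dimH (S.U 1) := by
  have : S.U k ⊆ ⋃ w : List ℕ, S.fw w '' S.U 1 := by
    intro x hx
    obtain ⟨w, y, rfl, hy⟩ := exists_univ hk ((mem_U hk).1 hx)
    exact mem_iUnion.2 ⟨w, y, mem_U1.2 hy, rfl⟩
  refine (dimH_mono this).trans ?_
  rw [dimH_iUnion]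
  exact iSup_le fun w => S.dimH_fw_le w _

theorem E_end {p q : ℕ} (hp : S.vd p) (hq : S.vd q)
    (h3 : ∀ j, S.vd j → j ≠ q → ∀ y ∈ S.I, S.f q y ∈ S.f j '' S.I → y ∉ S.f q '' S.I)
    (h8 : ∀ j, S.vd j → j ≠ q → ∀ x, x ∈ S.f j '' S.I → x ∈ S.f q '' S.I →
      ∃ u v : ℕ, 1 ≤ u ∧ (∀ z, S.f j ((S.f q)^[u] z) = S.f q ((S.f p)^[v] z)) ∧
        (∀ y ∈ S.I, S.f j y ∈ S.f q '' S.I → y ∈ (S.f q)^[u] '' S.I))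
    {y : ℝ} (hy : y ∈ S.E) (hyq : y ∈ S.f q '' S.I) : y ∈ S.f q '' S.E := by
  obtain ⟨ρ, h0, h1, hρ⟩ := S.exists_rho
  obtain ⟨C, hC⟩ : ∃ C, ∀ x ∈ S.E, ∀ z ∈ S.E, |x - z| ≤ C := by
    refine ⟨S.b - S.a, fun x hx z hz => ?_⟩
    have h1 := E_sub_I hx
    have h2 := E_sub_I hz
    rw [abs_le]
    constructor <;> linarith [h1.1, h1.2, h2.1, h2.2]
  have key : ∀ n : ℕ, ∀ y ∈ S.E, y ∈ S.f q '' S.I → ∃ z ∈ S.E, |y - S.f q z| ≤ ρ ^ n * C := by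
    intro n
    induction n with
    | zero =>
      intro y hy _
      exact ⟨y, hy, by simpa using hC _ hy _ (f_mem_E hq hy)⟩
    | succ n ih =>
      have sub : ∀ u : ℕ, ∀ y ∈ S.E, y ∈ (S.f q)^[u + 1] '' S.I →
          ∃ z ∈ S.E, |y - (S.f q)^[u + 1] z| ≤ ρ ^ n * C := by
        intro u
        induction u with
        | zero => intro y hy hy'; exact ih y hy (by simpa using hy')
        | succ u ihu =>
          intro y hy hy'
          obtain ⟨t, ht, rfl⟩ := hy'
          obtain ⟨j, s, hj, hs, e⟩ := E_cases hy
          rw [Function.iterate_succ_apply'] at e ⊢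
          by_cases hjq : j = q
          · subst hjq
            have e := f_inj hj e
            obtain ⟨z, hz, hzz⟩ := ihu s hs ⟨t, ht, e⟩
            refine ⟨z, hz, ?_⟩
            rw [Function.iterate_succ_apply' _ (u + 1) z, f_dist hj, e]
            have := (S.hr j hj.1 hj.2)
            refine le_trans ?_ hzz
            have h := abs_nonneg (s - (S.f j)^[u + 1] z)
            nlinarith [this.2]
          · exfalso
            refine h3 j hj hjq _ (iter_mem_I hq ht (u + 1)) ?_ ?_
            · rw [e]; exact ⟨s, E_sub_I hs, rfl⟩
            · exact iter_image hq (by omega) ⟨t, ht, rfl⟩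
      intro y hy hyq
      obtain ⟨j, s, hj, hs, rfl⟩ := E_cases hy
      by_cases hjq : j = q
      · subst hjq
        refine ⟨s, hs, ?_⟩
        have : 0 ≤ C := le_trans (abs_nonneg _) (hC _ hs _ hs)
        simp only [sub_self, abs_zero]; positivity
      · obtain ⟨u, v, hu, e, hI⟩ := h8 j hj hjq _ ⟨s, E_sub_I hs, rfl⟩ hyq
        obtain ⟨k, rfl⟩ : ∃ k, u = k + 1 := ⟨u - 1, by omega⟩
        obtain ⟨z, hz, hzz⟩ := sub k s hs (hI s (E_sub_I hs) hyq)
        refine ⟨(S.f p)^[v] z, iter_mem_E hp hz v, ?_⟩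
        rw [← e, f_dist hj, pow_succ', mul_assoc]
        have := hρ j hj
        gcongr
  have hcl : IsClosed (S.f q '' S.E) := (S.hEcpt.image (f_cont q)).isClosed
  rw [← hcl.closure_eq, Metric.mem_closure_iff]
  intro ε hε
  have ht : Tendsto (fun n : ℕ => ρ ^ n * C) atTop (nhds 0) := by
    have := (tendsto_pow_atTop_nhds_zero_of_lt_one h0 h1).mul_const C
    simpa using this
  obtain ⟨n, hn⟩ := (ht.eventually (gt_mem_nhds hε)).exists
  obtain ⟨z, hz, hzz⟩ := key n y hy hyq
  exact ⟨_, ⟨z, hz, rfl⟩, by rw [Real.dist_eq]; exact hzz.trans_lt hn⟩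

theorem iter_dist {i : ℕ} (hi : S.vd i) (n : ℕ) (x y : ℝ) :
    |(S.f i)^[n] x - (S.f i)^[n] y| = S.r i ^ n * |x - y| := by
  induction n with
  | zero => simp
  | succ n ih =>
    rw [Function.iterate_succ_apply', Function.iterate_succ_apply', f_dist hi, ih, pow_succ']
    ring

/-- dimension of `U 1` is carried by points outside `f q I`. -/
theorem dim_strip {q : ℕ} (hq : S.vd q)
    (h7 : ∀ y ∈ S.E, y ∈ S.f q '' S.I → y ∈ S.f q '' S.E) :
    dimH (S.U 1) ≤ dimH (S.U 1 \ S.f q '' S.I) := by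
  set V := S.U 1 \ S.f q '' S.I with hV
  set T : Set ℝ := {x | ∀ n : ℕ, x ∈ (S.f q)^[n] '' S.I} with hT
  have hTs : T.Subsingleton := by
    intro x hx y hy
    have hr := S.hr q hq.1 hq.2
    have ht : Tendsto (fun n : ℕ => S.r q ^ n * (S.b - S.a)) atTop (nhds 0) := by
      have := (tendsto_pow_atTop_nhds_zero_of_lt_one hr.1.le hr.2).mul_const (S.b - S.a)
      simpa using this
    have : |x - y| ≤ 0 := by
      refine ge_of_tendsto ht (Eventually.of_forall fun n => ?_)
      obtain ⟨s, hs, rfl⟩ := hx n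
      obtain ⟨t, ht, rfl⟩ := hy n
      rw [iter_dist hq]
      have h1 : |s - t| ≤ S.b - S.a := by
        rw [abs_le]
        constructor <;> linarith [hs.1, hs.2, ht.1, ht.2]
      have := pow_nonneg hr.1.le n
      gcongr
    exact sub_eq_zero.1 (abs_eq_zero.1 (le_antisymm this (abs_nonneg _)))
  have hstep : ∀ y ∈ S.U 1, y ∈ S.f q '' S.I → ∃ z ∈ S.U 1, y = S.f q z := by
    intro y hy hyq
    obtain ⟨z, hz, rfl⟩ := h7 y hy.1 hyq
    refine ⟨z, mem_U1.2 (le_antisymm ?_ (N_pos.2 hz)), rfl⟩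
    rw [← mem_U1.1 hy]
    exact N_le hq z
  have hcov : S.U 1 ⊆ T ∪ ⋃ n : ℕ, S.fw (List.replicate n q) '' V := by
    intro x hx
    by_cases hxT : x ∈ T
    · exact Or.inl hxT
    · right
      have hn : ∃ n : ℕ, x ∉ (S.f q)^[n] '' S.I := by
        by_contra h; push Not at h; exact hxT h
      obtain ⟨n, hn⟩ := hn
      clear hxT
      rw [mem_iUnion]
      induction n generalizing x with
      | zero => exact absurd ⟨x, E_sub_I hx.1, rfl⟩ hn
      | succ n ih =>
        by_cases hxq : x ∈ S.f q '' S.I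
        · obtain ⟨z, hz, rfl⟩ := hstep x hx hxq
          have hz' : z ∉ (S.f q)^[n] '' S.I := by
            rintro ⟨t, ht, rfl⟩
            exact hn ⟨t, ht, by rw [Function.iterate_succ_apply']⟩
          obtain ⟨k, y, hy, rfl⟩ := ih hz hz'
          exact ⟨k + 1, y, hy, rfl⟩
        · exact ⟨0, x, ⟨hx, hxq⟩, rfl⟩
  refine (dimH_mono hcov).trans ?_
  rw [dimH_union, dimH_iUnion, hTs.dimH_zero]
  exact max_le (zero_le) (iSup_le fun n => S.dimH_fw_le _ _)

theorem caseA {p q p' u v : ℕ} (Q : Prop) (hp : S.vd p) (hq : S.vd q) (hp' : S.vd p')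
    (hpp : p ≠ p') (hu : 1 ≤ u) (hv : 1 ≤ v)
    (h1 : ∀ j, S.vd j → j ≠ p → ∀ y ∈ S.I, S.f p y ∈ S.f j '' S.I → y ∈ S.f q '' S.I)
    (h2 : ∀ y, S.f p ((S.f q)^[u] y) = S.f p' ((S.f p)^[v] y))
    (h4 : ∀ j, S.vd j → j ≠ p → j ≠ p' → ∀ x, x ∈ S.f p '' S.I → x ∈ S.f p' '' S.I →
      x ∉ S.f j '' S.I)
    (h3 : ∀ j, S.vd j → j ≠ q → ∀ y ∈ S.I, S.f q y ∈ S.f j '' S.I → Q ∧ y ∈ S.f p '' S.I)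
    (h6 : ∀ x, x ∈ S.f p '' S.I → x ∉ S.f q '' S.I)
    (h5 : Q → ∃ c, S.vd c ∧ c ≠ p ∧ c ≠ q ∧ ∀ j, S.vd j → j ≠ c → ∀ y ∈ S.f p '' S.I,
      S.f c y ∉ S.f j '' S.I)
    (h8 : ∀ j, S.vd j → j ≠ q → ∀ x, x ∈ S.f j '' S.I → x ∈ S.f q '' S.I →
      ∃ u v : ℕ, 1 ≤ u ∧ (∀ z, S.f j ((S.f q)^[u] z) = S.f q ((S.f p)^[v] z)) ∧
        (∀ y ∈ S.I, S.f j y ∈ S.f q '' S.I → y ∈ (S.f q)^[u] '' S.I)) :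
    ∀ k : ℕ, 1 ≤ k → dimH (S.U k) = dimH (S.U 1) := by
  intro k hk
  refine le_antisymm (dim_upper hk) ?_
  have h7 : ∀ y ∈ S.E, y ∈ S.f q '' S.I → y ∈ S.f q '' S.E := fun y hy hyq =>
    E_end hp hq (fun j hj hjq y hy h => h6 _ (h3 j hj hjq y hy h).2) h8 hy hyq
  set B : Set ℝ := {y ∈ S.U 1 | y ∉ S.f q '' S.I ∧ (Q → y ∉ S.f p '' S.I)} with hB
  have hBU : dimH B ≤ dimH (S.U k) := by
    have hA : Aff (S.f p ∘ (S.f q)^[(k - 1) * u]) := (aff_f hp).comp ((aff_f hq).iter _)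
    refine dimH_le_of_aff hA ?_
    rintro y ⟨hy, hyq, hyp⟩
    have hyI : y ∈ S.I := E_sub_I hy.1
    have hN : S.N y = 1 := mem_U1.1 hy
    have hNq : ∀ j : ℕ, S.N ((S.f q)^[j] y) = 1 := by
      intro j
      induction j with
      | zero => exact hN
      | succ j ih =>
        rw [Function.iterate_succ_apply', N_eq hq, ih]
        intro l hl hlq hmem
        obtain ⟨hQ, hmem⟩ := h3 l hl hlq _ (iter_mem_I hq hyI j) hmem
        rcases Nat.eq_zero_or_pos j with rfl | hj
        · exact hyp hQ hmem
        · exact h6 _ hmem (iter_image hq hj ⟨y, hyI, rfl⟩)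
    have hNp : ∀ z ∈ S.f p '' S.I, ∀ j : ℕ, S.N ((S.f p)^[j] z) = S.N z := by
      intro z hz j
      have hzI : z ∈ S.I := by obtain ⟨t, ht, rfl⟩ := hz; exact f_mem_I hp ht
      induction j with
      | zero => rfl
      | succ j ih =>
        rw [Function.iterate_succ_apply', N_eq hp, ih]
        intro l hl hlq hmem
        have hmem := h1 l hl hlq _ (iter_mem_I hp hzI j) hmem
        refine h6 _ ?_ hmem
        rcases Nat.eq_zero_or_pos j with rfl | hj
        · exact hz
        · exact iter_image hp hj ⟨z, hzI, rfl⟩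
    have hP : ∀ n : ℕ, S.N (S.f p ((S.f q)^[n * u] y)) = ((n + 1 : ℕ) : ℕ∞) := by
      intro n
      induction n with
      | zero =>
        simp only [zero_mul, Function.iterate_zero, id]
        rw [N_eq hp, hN]; · simp
        intro l hl hlq hmem
        exact hyq (h1 l hl hlq _ hyI hmem)
      | succ n ih =>
        have hI := iter_mem_I hq hyI (n * u)
        have e : (S.f q)^[(n + 1) * u] y = (S.f q)^[u] ((S.f q)^[n * u] y) := by
          rw [← Function.iterate_add_apply]; congr 2; ring
        have e2 := h2 ((S.f q)^[n * u] y)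
        rw [e, N_add hp hp' hpp e2, ← e, hNq]
        · obtain ⟨v', rfl⟩ : ∃ v', v = v' + 1 := ⟨v - 1, by omega⟩
          rw [Function.iterate_succ_apply, hNp _ ⟨_, hI, rfl⟩, ih]
          push_cast; ring
        · intro l hl hlp hlp'
          refine h4 l hl hlp hlp' _ ⟨_, iter_mem_I hq hI u, rfl⟩ ?_
          rw [e2]
          exact ⟨_, iter_mem_I hp hI v, rfl⟩
    rw [mem_U hk, Function.comp_apply, hP]
    congr 1; omega
  refine le_trans ?_ hBU
  refine (dim_strip hq h7).trans ?_
  by_cases hQ : Q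
  · obtain ⟨c, hc, hcp, hcq, hcc⟩ := h5 hQ
    have hcov : S.U 1 \ S.f q '' S.I ⊆ B ∪ {y ∈ S.U 1 | y ∈ S.f p '' S.I} := by
      rintro y ⟨hy, hyq⟩
      by_cases hyp : y ∈ S.f p '' S.I
      · exact Or.inr ⟨hy, hyp⟩
      · exact Or.inl ⟨hy, hyq, fun _ => hyp⟩
    refine (dimH_mono hcov).trans ?_
    rw [dimH_union]
    refine max_le le_rfl (dimH_le_of_aff (aff_f hc) ?_)
    rintro y ⟨hy, hyp⟩
    refine ⟨?_, hcc q hq hcq.symm y hyp, fun _ => hcc p hp hcp.symm y hyp⟩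
    rw [mem_U1, N_eq hc, mem_U1.1 hy]
    exact fun j hj hjc => hcc j hj hjc y hyp
  · apply dimH_mono
    rintro y ⟨hy, hyq⟩
    exact ⟨hy, hyq, fun h => absurd h hQ⟩

theorem a_lt_b (hS : S.goodE) : S.a < S.b := by
  have hm := S.hm
  exact (aff_f (S := S) (i := S.m) ⟨by omega, le_rfl⟩).mono.lt_iff_lt.1 hS.1.2.2.1

theorem left_lt (hS : S.goodE) {i j : ℕ} (hi : 1 ≤ i) (hij : i ≤ j) (hj : j ≤ S.m) :
    S.f i S.a ≤ S.f j S.a := by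
  induction j, hij using Nat.le_induction with
  | base => exact le_rfl
  | succ j h ih => exact (ih (by omega)).trans (hS.1.2.1 j (by omega) (by omega)).le

theorem far (hS : S.goodE) {i j : ℕ} (hi : 1 ≤ i) (hij : i + 2 ≤ j) (hj : j ≤ S.m) {x : ℝ}
    (h1 : x ∈ S.f i '' S.I) (h2 : x ∈ S.f j '' S.I) : False := by
  have hab := (a_lt_b hS).le
  have hvi : S.vd i := ⟨hi, by omega⟩
  have hvi2 : S.vd (i + 2) := ⟨by omega, by omega⟩
  have hvj : S.vd j := ⟨by omega, hj⟩
  have key : S.f i S.b < S.f (i + 2) S.a := by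
    by_contra hle
    push Not at hle
    obtain ⟨y, hy⟩ := exists_inv hvi (S.f (i + 2) S.a)
    have : S.f (i + 2) S.a ∈ S.f i '' S.I ∩ S.f (i + 2) '' S.I := by
      refine ⟨⟨y, ⟨?_, ?_⟩, hy.symm⟩, ⟨S.a, ⟨le_rfl, hab⟩, rfl⟩⟩
      · rw [← (aff_f hvi).mono.le_iff_le, ← hy]
        exact left_lt hS hi (by omega) (by omega)
      · rw [← (aff_f hvi).mono.le_iff_le, ← hy]
        exact hle
    rw [hS.2.1 i hi (by omega)] at this
    exact this
  have h3 := left_lt hS (show 1 ≤ i + 2 by omega) hij hj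
  obtain ⟨y, hy, rfl⟩ := h1
  obtain ⟨z, hz, e⟩ := h2
  have := (aff_f hvi).mono.monotone hy.2
  have := (aff_f hvj).mono.monotone hz.1
  linarith

theorem near (hS : S.goodE) {i j : ℕ} (hi : S.vd i) (hj : S.vd j) (hij : i ≠ j) {x : ℝ}
    (h1 : x ∈ S.f i '' S.I) (h2 : x ∈ S.f j '' S.I) : j = i + 1 ∨ i = j + 1 := by
  by_contra h
  push Not at h
  rcases lt_or_gt_of_ne hij with h' | h'
  · exact far hS hi.1 (by omega) hj.2 h1 h2
  · exact far hS hj.1 (by omega) hi.2 h2 h1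

theorem overlap (hS : S.goodE) {i : ℕ} (hi : 1 ≤ i) (him : i + 1 ≤ S.m) {x : ℝ}
    (h1 : x ∈ S.f i '' S.I) (h2 : x ∈ S.f (i + 1) '' S.I) :
    ∃ u v : ℕ, 1 ≤ u ∧ 1 ≤ v ∧ (∀ z, S.f i ((S.f S.m)^[u] z) = S.f (i + 1) ((S.f 1)^[v] z)) ∧
      (∀ y ∈ S.I, S.f i y ∈ S.f (i + 1) '' S.I → y ∈ (S.f S.m)^[u] '' S.I) ∧
      (∀ y ∈ S.I, S.f (i + 1) y ∈ S.f i '' S.I → y ∈ (S.f 1)^[v] '' S.I) := by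
  have hm := S.hm
  have hvi : S.vd i := ⟨hi, by omega⟩
  have hvi1 : S.vd (i + 1) := ⟨by omega, by omega⟩
  have hv1 : S.vd 1 := ⟨by omega, by omega⟩
  have hvm : S.vd S.m := ⟨by omega, by omega⟩
  obtain ⟨u, v, hu, hv, e1, e2⟩ := hS.2.2.2 i hi him (Set.nonempty_iff_ne_empty.1 ⟨x, h1, h2⟩)
  refine ⟨u, v, hu, hv, ?_, ?_, ?_⟩
  · exact Aff.eq_of_image ((aff_f hvi).comp ((aff_f hvm).iter u))
      ((aff_f hvi1).comp ((aff_f hv1).iter v)) (a_lt_b hS) (e1.symm.trans e2)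
  · intro y hy h
    have : S.f i y ∈ S.f i '' S.I ∩ S.f (i + 1) '' S.I := ⟨⟨y, hy, rfl⟩, h⟩
    rw [e1] at this
    obtain ⟨z, hz, e⟩ := this
    exact ⟨z, hz, f_inj hvi e⟩
  · intro y hy h
    have : S.f (i + 1) y ∈ S.f i '' S.I ∩ S.f (i + 1) '' S.I := ⟨h, ⟨y, hy, rfl⟩⟩
    rw [e2] at this
    obtain ⟨z, hz, e⟩ := this
    exact ⟨z, hz, f_inj hvi1 e⟩

/-- the two intervals overlap -/
def ov (S : ClassE) (i : ℕ) : Prop := ∃ x, x ∈ S.f i '' S.I ∧ x ∈ S.f (i + 1) '' S.I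

/-- passing from digit `i` up -/
theorem up_mem (hS : S.goodE) {i : ℕ} (hi : 1 ≤ i) (him : i + 1 ≤ S.m) {y : ℝ} (hy : y ∈ S.I)
    (h : S.f i y ∈ S.f (i + 1) '' S.I) : y ∈ S.f S.m '' S.I := by
  obtain ⟨u, v, hu, hv, -, h1, -⟩ := overlap hS hi him ⟨y, hy, rfl⟩ h
  exact iter_image ⟨by omega, le_rfl⟩ hu (h1 y hy h)

theorem down_mem (hS : S.goodE) {i : ℕ} (hi : 1 ≤ i) (him : i + 1 ≤ S.m) {y : ℝ} (hy : y ∈ S.I)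
    (h : S.f (i + 1) y ∈ S.f i '' S.I) : y ∈ S.f 1 '' S.I := by
  obtain ⟨u, v, hu, hv, -, -, h1⟩ := overlap hS hi him h ⟨y, hy, rfl⟩
  exact iter_image ⟨by omega, by omega⟩ hv (h1 y hy h)

theorem exists_gap (hS : S.goodE) : ∃ i, 1 ≤ i ∧ i + 1 ≤ S.m ∧ ¬ S.ov i := by
  obtain ⟨i, h1, h2, h3⟩ := hS.2.2.1.1
  refine ⟨i, h1, h2, fun ⟨x, hx1, hx2⟩ => ?_⟩
  have : x ∈ S.f i '' S.I ∩ S.f (i + 1) '' S.I := ⟨hx1, hx2⟩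
  rw [h3] at this; exact this

theorem exists_ov (hS : S.goodE) : ∃ i, 1 ≤ i ∧ i + 1 ≤ S.m ∧ S.ov i := by
  obtain ⟨i, h1, h2, h3⟩ := hS.2.2.1.2
  exact ⟨i, h1, h2, Set.nonempty_iff_ne_empty.2 h3⟩

theorem case_left (hS : S.goodE) (h : S.ov 1) :
    ∀ k : ℕ, 1 ≤ k → dimH (S.U k) = dimH (S.U 1) := by
  have hm := S.hm
  obtain ⟨n, hn⟩ : ∃ n, S.m = n + 1 := ⟨S.m - 1, by omega⟩
  have hv1 : S.vd 1 := ⟨by omega, by omega⟩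
  have hv2 : S.vd 2 := ⟨by omega, by omega⟩
  have hvm : S.vd S.m := ⟨by omega, by omega⟩
  have h0 := h
  obtain ⟨x, hx1, hx2⟩ := h
  obtain ⟨u, v, hu, hv, e, -, -⟩ := overlap hS le_rfl (by omega) hx1 hx2
  refine caseA (p := 1) (q := S.m) (p' := 2) (S.ov n) hv1 hvm hv2 (by omega) hu hv
    ?_ e ?_ ?_ ?_ ?_ ?_
  · intro j hj hj1 y hy hmem
    have hj2 : j = 2 := by
      have := near hS hv1 hj (Ne.symm hj1) ⟨y, hy, rfl⟩ hmem
      have := hj.1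
      omega
    subst hj2
    exact up_mem hS le_rfl (by omega) hy hmem
  · intro j hj hj1 hj2 x hx1 hx2 hx
    have := near hS hv1 hj (Ne.symm hj1) hx1 hx
    have := hj.1
    omega
  · intro j hj hjm y hy hmem
    have hjn : n = j := by
      have := near hS hvm hj (Ne.symm hjm) ⟨y, hy, rfl⟩ hmem
      have := hj.2
      omega
    subst hjn
    rw [hn] at hmem
    exact ⟨⟨_, hmem, ⟨y, hy, rfl⟩⟩, down_mem hS hj.1 (by omega) hy hmem⟩
  · intro x h1 h2
    exact far hS le_rfl (by omega) le_rfl h1 h2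
  · intro hQ
    obtain ⟨i, hi, him, hgap⟩ := exists_gap hS
    have hi1 : i ≠ 1 := by rintro rfl; exact hgap h0
    have hin : i ≠ n := by rintro rfl; exact hgap hQ
    have hc : S.vd (i + 1) := ⟨by omega, by omega⟩
    refine ⟨i + 1, hc, by omega, by omega, ?_⟩
    intro j hj hjc y hy hmem
    have hyI : y ∈ S.I := by obtain ⟨t, ht, rfl⟩ := hy; exact f_mem_I hv1 ht
    rcases near hS hc hj (Ne.symm hjc) ⟨y, hyI, rfl⟩ hmem with h | h
    · subst h
      exact far hS le_rfl (by omega) le_rfl hy (up_mem hS (by omega) hj.2 hyI hmem)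
    · have : i = j := by omega
      subst this
      exact hgap ⟨_, hmem, ⟨y, hyI, rfl⟩⟩
  · intro j hj hjm x hxj hxm
    have hjn : n = j := by
      have := near hS hvm hj (Ne.symm hjm) hxm hxj
      have := hj.2
      omega
    subst hjn
    have hxm' := hxm
    rw [hn] at hxm'
    obtain ⟨u, v, hu, hv, e, h1, -⟩ := overlap hS hj.1 (by omega) hxj hxm'
    rw [← hn] at e h1
    exact ⟨u, v, hu, e, h1⟩

theorem case_right (hS : S.goodE) {n : ℕ} (hn : S.m = n + 1) (h : S.ov n) :
    ∀ k : ℕ, 1 ≤ k → dimH (S.U k) = dimH (S.U 1) := by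
  have hm := S.hm
  have hv1 : S.vd 1 := ⟨by omega, by omega⟩
  have hv2 : S.vd n := ⟨by omega, by omega⟩
  have hvm : S.vd S.m := ⟨by omega, by omega⟩
  have h0 := h
  obtain ⟨x, hx1, hx2⟩ := h
  obtain ⟨u, v, hu, hv, e, -, -⟩ := overlap hS hv2.1 (by omega) hx1 hx2
  rw [← hn] at e
  refine caseA (p := S.m) (q := 1) (p' := n) (S.ov 1) hvm hv1 hv2 (by omega) hv hu
    ?_ (fun y => (e y).symm) ?_ ?_ ?_ ?_ ?_
  · intro j hj hjm y hy hmem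
    have hjn : n = j := by
      have := near hS hvm hj (Ne.symm hjm) ⟨y, hy, rfl⟩ hmem
      have := hj.2
      omega
    subst hjn
    rw [hn] at hmem
    exact down_mem hS hj.1 (by omega) hy hmem
  · intro j hj hj1 hj2 x hx1 hx2 hx
    have := near hS hvm hj (Ne.symm hj1) hx1 hx
    have := hj.2
    omega
  · intro j hj hj1 y hy hmem
    have hj2 : j = 2 := by
      have := near hS hv1 hj (Ne.symm hj1) ⟨y, hy, rfl⟩ hmem
      have := hj.1
      omega
    subst hj2
    exact ⟨⟨_, ⟨y, hy, rfl⟩, hmem⟩, up_mem hS le_rfl (by omega) hy hmem⟩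
  · intro x h1 h2
    exact far hS le_rfl (by omega) le_rfl h2 h1
  · intro hQ
    obtain ⟨i, hi, him, hgap⟩ := exists_gap hS
    have hi1 : i ≠ 1 := by rintro rfl; exact hgap hQ
    have hin : i ≠ n := by rintro rfl; exact hgap h0
    have hc : S.vd i := ⟨by omega, by omega⟩
    refine ⟨i, hc, by omega, by omega, ?_⟩
    intro j hj hjc y hy hmem
    have hyI : y ∈ S.I := by obtain ⟨t, ht, rfl⟩ := hy; exact f_mem_I hvm ht
    rcases near hS hc hj (Ne.symm hjc) ⟨y, hyI, rfl⟩ hmem with h | h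
    · subst h
      exact hgap ⟨_, ⟨y, hyI, rfl⟩, hmem⟩
    · subst h
      exact far hS le_rfl (by omega) le_rfl (down_mem hS hj.1 (by omega) hyI hmem) hy
  · intro j hj hj1 x hxj hx1
    have hj2 : j = 2 := by
      have := near hS hv1 hj (Ne.symm hj1) hx1 hxj
      have := hj.1
      omega
    subst hj2
    obtain ⟨u, v, hu, hv, e, -, h1⟩ := overlap hS le_rfl (by omega) hx1 hxj
    exact ⟨v, u, hv, fun z => (e z).symm, h1⟩

/-- doubling in the case without overlaps at the ends -/
theorem N_double (hS : S.goodE) {n : ℕ} (hn : S.m = n + 1) (h1 : ¬ S.ov 1) (h2 : ¬ S.ov n)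
    {i : ℕ} (hi : 1 ≤ i) (him : i + 1 ≤ S.m) (h : S.ov i) :
    ∃ u : ℕ, (∀ z ∈ S.I, S.N (S.f i ((S.f S.m)^[u] z)) = 2 * S.N z) ∧
      (∀ y ∈ S.I, S.f i y ∈ S.f (i + 1) '' S.I → y ∈ (S.f S.m)^[u] '' S.I) := by
  have hm := S.hm
  have hv1 : S.vd 1 := ⟨by omega, by omega⟩
  have hvm : S.vd S.m := ⟨by omega, by omega⟩
  have hvi : S.vd i := ⟨by omega, by omega⟩
  have hvi1 : S.vd (i + 1) := ⟨by omega, by omega⟩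
  obtain ⟨x, hx1, hx2⟩ := h
  obtain ⟨u, v, hu, hv, e, h3, -⟩ := overlap hS hi him hx1 hx2
  refine ⟨u, fun z hz => ?_, h3⟩
  have hNm : ∀ j : ℕ, S.N ((S.f S.m)^[j] z) = S.N z := by
    intro j
    induction j with
    | zero => rfl
    | succ j ih =>
      rw [Function.iterate_succ_apply', N_eq hvm, ih]
      intro l hl hlm hmem
      have hI := iter_mem_I hvm hz j
      have hln : n = l := by
        have := near hS hvm hl (Ne.symm hlm) ⟨_, hI, rfl⟩ hmem
        have := hl.2
        omega
      subst hln
      exact h2 ⟨_, hmem, by rw [← hn]; exact ⟨_, hI, rfl⟩⟩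
  have hN1 : ∀ j : ℕ, S.N ((S.f 1)^[j] z) = S.N z := by
    intro j
    induction j with
    | zero => rfl
    | succ j ih =>
      rw [Function.iterate_succ_apply', N_eq hv1, ih]
      intro l hl hl1 hmem
      have hI := iter_mem_I hv1 hz j
      have hl2 : l = 2 := by
        have := near hS hv1 hl (Ne.symm hl1) ⟨_, hI, rfl⟩ hmem
        have := hl.1
        omega
      subst hl2
      exact h1 ⟨_, ⟨_, hI, rfl⟩, hmem⟩
  rw [N_add hvi hvi1 (by omega) (e z), hNm, hN1, two_mul]
  intro l hl hli hli1 hmem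
  have m1 : S.f i ((S.f S.m)^[u] z) ∈ S.f i '' S.I := ⟨_, iter_mem_I hvm hz u, rfl⟩
  have m2 : S.f i ((S.f S.m)^[u] z) ∈ S.f (i + 1) '' S.I := by
    rw [e z]; exact ⟨_, iter_mem_I hv1 hz v, rfl⟩
  have := near hS hvi hl (Ne.symm hli) m1 hmem
  have := near hS hvi1 hl (Ne.symm hli1) m2 hmem
  omega

theorem pow_two (hS : S.goodE) {n : ℕ} (hn : S.m = n + 1) (h1 : ¬ S.ov 1) (h2 : ¬ S.ov n)
    {k : ℕ} (hk : 1 ≤ k) {x : ℝ} (hx : S.N x = k) : ∃ s : ℕ, k = 2 ^ s := by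
  induction k using Nat.strong_induction_on generalizing x with
  | _ k ih =>
    rcases Nat.lt_or_ge 1 k with h | h
    · obtain ⟨w, y, rfl, hy, d, d', hd, hd', hne⟩ := branch h hx
      have hb : ∃ i, 1 ≤ i ∧ i + 1 ≤ S.m ∧ y ∈ S.f i '' S.I ∧ y ∈ S.f (i + 1) '' S.I := by
        have m1 := coding_first hd
        have m2 := coding_first hd'
        have v1 := hd.1 0
        have v2 := hd'.1 0
        rcases near hS v1 v2 hne m1 m2 with h | h
        · rw [h] at m2 v2
          exact ⟨_, v1.1, v2.2, m1, m2⟩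
        · rw [h] at m1 v1
          exact ⟨_, v2.1, v1.2, m2, m1⟩
      obtain ⟨i, hi, him, m1, m2⟩ := hb
      obtain ⟨u, hu, hu'⟩ := N_double hS hn h1 h2 hi him ⟨y, m1, m2⟩
      obtain ⟨z, hz, rfl⟩ := m1
      obtain ⟨z, hz', rfl⟩ := hu' z hz m2
      rw [hu z hz'] at hy
      have hnt : S.N z ≠ ⊤ := by
        intro h; rw [h] at hy; simp at hy
      obtain ⟨l, hl⟩ := ENat.ne_top_iff_exists.1 hnt
      rw [← hl] at hy
      have hy : 2 * l = k := by exact_mod_cast hy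
      obtain ⟨s, hs⟩ := ih l (by omega) (by omega) hl.symm
      exact ⟨s + 1, by rw [← hy, hs, pow_succ]; ring⟩
    · exact ⟨0, by simp; omega⟩

theorem case_mid (hS : S.goodE) {n : ℕ} (hn : S.m = n + 1) (h1 : ¬ S.ov 1) (h2 : ¬ S.ov n)
    (s : ℕ) : dimH (S.U (2 ^ s : ℕ)) = dimH (S.U 1) := by
  have hm := S.hm
  refine le_antisymm (dim_upper Nat.one_le_two_pow) ?_
  obtain ⟨i, hi, him, h⟩ := exists_ov hS
  obtain ⟨u, hu, -⟩ := N_double hS hn h1 h2 hi him h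
  have hvm : S.vd S.m := ⟨by omega, by omega⟩
  have hvi : S.vd i := ⟨by omega, by omega⟩
  have hA : Aff (S.f i ∘ (S.f S.m)^[u]) := (aff_f hvi).comp ((aff_f hvm).iter _)
  refine dimH_le_of_aff (hA.iter s) ?_
  intro y hy
  rw [mem_U Nat.one_le_two_pow]
  have hyI := E_sub_I hy.1
  have : ∀ s : ℕ, (S.f i ∘ (S.f S.m)^[u])^[s] y ∈ S.I ∧
      S.N ((S.f i ∘ (S.f S.m)^[u])^[s] y) = ((2 ^ s : ℕ) : ℕ∞) := by
    intro s
    induction s with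
    | zero => exact ⟨hyI, by simpa using mem_U1.1 hy⟩
    | succ s ih =>
      rw [Function.iterate_succ_apply', Function.comp_apply]
      refine ⟨f_mem_I hvi (iter_mem_I hvm ih.1 u), ?_⟩
      rw [hu _ ih.1, ih.2]
      push_cast; ring
  exact (this s).2

end ClassE

open ClassE

theorem stmt3 (S : ClassE) (hS : S.goodE) :
    (∀ k : ℕ, 1 ≤ k → dimH (S.U k) = dimH (S.U 1)) ∨
      ((∀ s : ℕ, dimH (S.U (2 ^ s : ℕ)) = dimH (S.U 1)) ∧
        (∀ k : ℕ, 1 ≤ k → ¬ (∃ s : ℕ, k = 2 ^ s) → S.U k = ∅)) := by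
  have hm := S.hm
  obtain ⟨n, hn⟩ : ∃ n, S.m = n + 1 := ⟨S.m - 1, by omega⟩
  by_cases h1 : S.ov 1
  · exact Or.inl (case_left hS h1)
  by_cases h2 : S.ov n
  · exact Or.inl (case_right hS hn h2)
  right
  refine ⟨case_mid hS hn h1 h2, fun k hk hs => ?_⟩
  by_contra hne
  obtain ⟨x, hx⟩ := Set.nonempty_iff_ne_empty.2 hne
  exact hs (pow_two hS hn h1 h2 hk ((mem_U hk).1 hx))
end
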